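/- arXiv:2210.12376 — 2 statements merged into one kernel-verified Lean document; each statement's English description precedes it below -/
import Mathlib

section
/- In the setup below, if x is an internal vertex of L1, then |Q1| = 1, |P1| = |L1| = ℓ, |P'| = 2ℓ−1, the edges xu3 and yu3 belong to H, and the cycle x u3 y together with the path P' is an odd hole of G. -/
open SimpleGraph

variable {V : Type*}

/-- The list of internal vertices of a walk (its support minus the two ends). -/
def interiorL {G : SimpleGraph V} {a b : V} (p : G.Walk a b) : List V :=
  p.support.tail.dropLast

/-- `p` is an induced path of `G`: a path such that the only edges of `G` between
vertices of `p` are the edges of `p`. -/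
def IsInducedPath (G : SimpleGraph V) {a b : V} (p : G.Walk a b) : Prop :=
  p.IsPath ∧ ∀ x ∈ p.support, ∀ y ∈ p.support, G.Adj x y → s(x, y) ∈ p.edges

/-- A hole of `G`: an induced (chordless) cycle of length at least 4. -/
def IsHole (G : SimpleGraph V) {v : V} (c : G.Walk v v) : Prop :=
  c.IsCycle ∧ 4 ≤ c.length ∧
    ∀ x ∈ c.support, ∀ y ∈ c.support, G.Adj x y → s(x, y) ∈ c.edges

/-- An odd hole of `G`: a hole of odd length. -/
def IsOddHole (G : SimpleGraph V) {v : V} (c : G.Walk v v) : Prop :=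
  IsHole G c ∧ Odd c.length

/-- `G ∈ 𝒢ℓ`: `G` has girth `2ℓ+1` and every odd hole of `G` has length exactly `2ℓ+1`
(equivalently, no odd hole of length at least `2ℓ+3`). -/
def InGFamily (ℓ : ℕ) (G : SimpleGraph V) : Prop :=
  G.egirth = (2 * ℓ + 1 : ℕ) ∧
    ∀ (v : V) (c : G.Walk v v), IsOddHole G c → c.length = 2 * ℓ + 1

/-- `G` is `k`-vertex-critical: `χ(G) = k` and `χ(G − v) < k` for every vertex `v`. -/
def VertexCritical (k : ℕ) (G : SimpleGraph V) : Prop :=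
  G.chromaticNumber = (k : ℕ∞) ∧
    ∀ v : V, (G.induce ({v}ᶜ : Set V)).chromaticNumber < (k : ℕ∞)

/-- An odd `K₄`-subdivision in `G`: four distinct branch vertices `u1, u2, u3, u4`
joined by six internally disjoint paths (the arrises), such that the four face cycles
are all odd holes of `G`. -/
structure OddK4 (G : SimpleGraph V) where
  u1 : V
  u2 : V
  u3 : V
  u4 : V
  /-- the arris joining `u1` and `u2` -/
  P1 : G.Walk u1 u2
  /-- the arris joining `u3` and `u4` -/
  P2 : G.Walk u3 u4
  /-- the arris joining `u2` and `u3` -/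
  Q1 : G.Walk u2 u3
  /-- the arris joining `u1` and `u4` -/
  Q2 : G.Walk u1 u4
  /-- the arris joining `u1` and `u3` -/
  L1 : G.Walk u1 u3
  /-- the arris joining `u2` and `u4` -/
  L2 : G.Walk u2 u4
  hP1 : P1.IsPath
  hP2 : P2.IsPath
  hQ1 : Q1.IsPath
  hQ2 : Q2.IsPath
  hL1 : L1.IsPath
  hL2 : L2.IsPath
  /-- the four branch vertices are pairwise distinct -/
  hnodup : List.Nodup [u1, u2, u3, u4]
  /-- the interiors of the six arrises are pairwise disjoint -/
  hdisj : List.Pairwise List.Disjoint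
    [interiorL P1, interiorL P2, interiorL Q1, interiorL Q2, interiorL L1, interiorL L2]
  /-- no branch vertex lies in the interior of an arris -/
  hbranch : ∀ x ∈ interiorL P1 ++ interiorL P2 ++ interiorL Q1 ++ interiorL Q2 ++
      interiorL L1 ++ interiorL L2, x ∉ [u1, u2, u3, u4]
  /-- the face `u1u2u3` is an odd hole of `G` -/
  face1 : IsOddHole G (P1.append (Q1.append L1.reverse))
  /-- the face `u1u2u4` is an odd hole of `G` -/
  face2 : IsOddHole G (P1.append (L2.append Q2.reverse))
  /-- the face `u1u3u4` is an odd hole of `G` -/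
  face3 : IsOddHole G (L1.append (P2.append Q2.reverse))
  /-- the face `u2u3u4` is an odd hole of `G` -/
  face4 : IsOddHole G (Q1.append (P2.append L2.reverse))

/-- The subgraph of `G` formed by an odd `K₄`-subdivision. -/
def OddK4.toSubgraph {G : SimpleGraph V} (K : OddK4 G) : G.Subgraph :=
  K.P1.toSubgraph ⊔ K.P2.toSubgraph ⊔ K.Q1.toSubgraph ⊔ K.Q2.toSubgraph ⊔
    K.L1.toSubgraph ⊔ K.L2.toSubgraph

/-- The vertex set of an odd `K₄`-subdivision. -/
def OddK4.verts {G : SimpleGraph V} (K : OddK4 G) : Set V :=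
  K.toSubgraph.verts

/-- `P1, P2` form a pair of longest arrises of the odd `K₄`-subdivision `K`. -/
def OddK4.longestPair {G : SimpleGraph V} (K : OddK4 G) : Prop :=
  K.Q1.length ≤ K.P1.length ∧ K.Q2.length ≤ K.P1.length ∧
    K.L1.length ≤ K.P1.length ∧ K.L2.length ≤ K.P1.length ∧
    K.Q1.length ≤ K.P2.length ∧ K.Q2.length ≤ K.P2.length ∧
    K.L1.length ≤ K.P2.length ∧ K.L2.length ≤ K.P2.length

/-- The difference `d(H) = |P1| − min(|Q1|, |L1|)` of an odd `K₄`-subdivision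
(labelled so that `P1, P2` is a pair of longest arrises). -/
def OddK4.diff {G : SimpleGraph V} (K : OddK4 G) : ℕ :=
  K.P1.length - min K.Q1.length K.L1.length

namespace SimpleGraph.Walk

variable {G : SimpleGraph V} {u v w : V}

lemma IsPath.append_of_inter {p : G.Walk u v} {q : G.Walk v w} (hp : p.IsPath) (hq : q.IsPath)
    (h : ∀ z ∈ p.support, z ∈ q.support → z = v) : (p.append q).IsPath := by
  have hq' := hq.support_nodup
  rw [← cons_tail_support, List.nodup_cons] at hq'
  rw [isPath_def, support_append, List.nodup_append']
  refine ⟨hp.support_nodup, hq'.2, fun z hz hz' ↦ hq'.1 ?_⟩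
  exact h z hz (List.mem_of_mem_tail hz') ▸ hz'

lemma IsPath.isCycle_append_of_inter {p : G.Walk u v} {q : G.Walk v u} (hp : p.IsPath)
    (hq : q.IsPath) (h : ∀ z ∈ p.support, z ∈ q.support → z = u ∨ z = v)
    (hn : 1 < p.length ∨ 1 < q.length) : (p.append q).IsCycle := by
  refine hp.isCycle_append hq (fun z hz hz' ↦ ?_) hn
  have hp' := hp.support_nodup
  have hq' := hq.support_nodup
  rw [← cons_tail_support, List.nodup_cons] at hp' hq'
  rcases h z (List.mem_of_mem_tail hz) (List.mem_of_mem_tail hz') with rfl | rfl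
  exacts [hp'.1 hz, hq'.1 hz']

end SimpleGraph.Walk

section Prism

variable {G : SimpleGraph V} {ℓ : ℕ}

lemma InGFamily.le_length (hG : InGFamily ℓ G) {v : V} {c : G.Walk v v} (hc : c.IsCycle) :
    2 * ℓ + 1 ≤ c.length := by
  have := hG.1 ▸ egirth_le_length hc
  exact_mod_cast this

lemma InGFamily.le_length_add_one (hG : InGFamily ℓ G) {u v : V} {p : G.Walk u v}
    (hp : p.IsPath) (h : G.Adj v u) (h2 : p.length ≠ 1) : 2 * ℓ + 1 ≤ p.length + 1 := by
  have hc : (Walk.cons h p).IsCycle := (Walk.cons_isCycle_iff p h).2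
    ⟨hp, fun he ↦ h2 (hp.length_eq_one_of_mem_edges (Sym2.eq_swap ▸ he))⟩
  simpa using hG.le_length hc

/-- An induced subdivision of the triangular prism, with triangles `a0 a1 a2` and `c0 c1 c2`
and rungs `a0 c0`, `a1 c1`, `a2 c2`. The function `lab` tells the six branch vertices
(labels `0` to `5`) and the interiors of the nine subdivided edges (labels `6` to `14`) apart. -/
structure InducedPrism (G : SimpleGraph V) where
  a0 : V
  a1 : V
  a2 : V
  c0 : V
  c1 : V
  c2 : V
  A01 : G.Walk a0 a1
  A02 : G.Walk a0 a2
  A12 : G.Walk a1 a2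
  C01 : G.Walk c0 c1
  C02 : G.Walk c0 c2
  C12 : G.Walk c1 c2
  R0 : G.Walk a0 c0
  R1 : G.Walk a1 c1
  R2 : G.Walk a2 c2
  hA01 : A01.IsPath
  hA02 : A02.IsPath
  hA12 : A12.IsPath
  hC01 : C01.IsPath
  hC02 : C02.IsPath
  hC12 : C12.IsPath
  hR0 : R0.IsPath
  hR1 : R1.IsPath
  hR2 : R2.IsPath
  lab : V → ℕ
  lab_a0 : ∀ z, lab z = 0 ↔ z = a0
  lab_a1 : ∀ z, lab z = 1 ↔ z = a1
  lab_a2 : ∀ z, lab z = 2 ↔ z = a2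
  lab_c0 : ∀ z, lab z = 3 ↔ z = c0
  lab_c1 : ∀ z, lab z = 4 ↔ z = c1
  lab_c2 : ∀ z, lab z = 5 ↔ z = c2
  lab_A01 : ∀ z ∈ A01.support, lab z = 0 ∨ lab z = 1 ∨ lab z = 6
  lab_A02 : ∀ z ∈ A02.support, lab z = 0 ∨ lab z = 2 ∨ lab z = 7
  lab_A12 : ∀ z ∈ A12.support, lab z = 1 ∨ lab z = 2 ∨ lab z = 8
  lab_C01 : ∀ z ∈ C01.support, lab z = 3 ∨ lab z = 4 ∨ lab z = 9
  lab_C02 : ∀ z ∈ C02.support, lab z = 3 ∨ lab z = 5 ∨ lab z = 10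
  lab_C12 : ∀ z ∈ C12.support, lab z = 4 ∨ lab z = 5 ∨ lab z = 11
  lab_R0 : ∀ z ∈ R0.support, lab z = 0 ∨ lab z = 3 ∨ lab z = 12
  lab_R1 : ∀ z ∈ R1.support, lab z = 1 ∨ lab z = 4 ∨ lab z = 13
  lab_R2 : ∀ z ∈ R2.support, lab z = 2 ∨ lab z = 5 ∨ lab z = 14
  induced : ∀ z w, lab z < 15 → lab w < 15 → G.Adj z w →
    s(z, w) ∈ A01.edges ∨ s(z, w) ∈ A02.edges ∨ s(z, w) ∈ A12.edges ∨
    s(z, w) ∈ C01.edges ∨ s(z, w) ∈ C02.edges ∨ s(z, w) ∈ C12.edges ∨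
    s(z, w) ∈ R0.edges ∨ s(z, w) ∈ R1.edges ∨ s(z, w) ∈ R2.edges

namespace InducedPrism

variable (S : InducedPrism G)

lemma length_pos_of_ne {u v : V} (p : G.Walk u v) (h : u ≠ v) : 1 ≤ p.length := by
  rw [Nat.one_le_iff_ne_zero]
  exact fun h0 ↦ h (Walk.eq_of_length_eq_zero h0)

lemma lengths_pos : 1 ≤ S.A01.length ∧ 1 ≤ S.A02.length ∧ 1 ≤ S.A12.length ∧
    1 ≤ S.C01.length ∧ 1 ≤ S.C02.length ∧ 1 ≤ S.C12.length ∧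
    1 ≤ S.R0.length ∧ 1 ≤ S.R1.length ∧ 1 ≤ S.R2.length := by
  have h0 := (S.lab_a0 _).2 rfl
  have h1 := (S.lab_a1 _).2 rfl
  have h2 := (S.lab_a2 _).2 rfl
  have h3 := (S.lab_c0 _).2 rfl
  have h4 := (S.lab_c1 _).2 rfl
  have h5 := (S.lab_c2 _).2 rfl
  refine ⟨?_, ?_, ?_, ?_, ?_, ?_, ?_, ?_, ?_⟩ <;> apply length_pos_of_ne <;> intro h <;>
    simp_all

lemma mem_edges_of_lab {x u v z w : V} {c : G.Walk x x} {L : List ℕ} {i j k : ℕ}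
    (hL : ∀ z ∈ c.support, S.lab z ∈ L) {p : G.Walk u v} (hp : p.IsPath)
    (hu : ∀ z, S.lab z = i ↔ z = u) (hv : ∀ z, S.lab z = j ↔ z = v)
    (hlab : ∀ z ∈ p.support, S.lab z = i ∨ S.lab z = j ∨ S.lab z = k)
    (h : p.edges ⊆ c.edges ∨ k ∉ L ∧ (2 ≤ p.length ∨ i ∉ L ∨ j ∉ L))
    (hz : z ∈ c.support) (hw : w ∈ c.support) (he : s(z, w) ∈ p.edges) :
    s(z, w) ∈ c.edges := by
  rcases h with h | ⟨hk, h⟩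
  · exact h he
  have key : ∀ t ∈ p.support, t ∈ c.support → t = u ∨ t = v := fun t ht ht' ↦ by
    rcases hlab t ht with h | h | h
    · exact .inl ((hu t).1 h)
    · exact .inr ((hv t).1 h)
    · exact absurd (h ▸ hL t ht') hk
  have hne := (p.adj_of_mem_edges he).ne
  have huv : s(u, v) ∈ p.edges ∧ u ∈ c.support ∧ v ∈ c.support := by
    rcases key z (p.fst_mem_support_of_mem_edges he) hz with rfl | rfl <;>
      rcases key w (p.snd_mem_support_of_mem_edges he) hw with rfl | rfl
    · exact absurd rfl hne
    · exact ⟨he, hz, hw⟩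
    · exact ⟨Sym2.eq_swap ▸ he, hw, hz⟩
    · exact absurd rfl hne
  have := hp.length_eq_one_of_mem_edges huv.1
  rcases h with h | h | h
  · omega
  · exact absurd ((hu u).2 rfl ▸ hL u huv.2.1) h
  · exact absurd ((hv v).2 rfl ▸ hL v huv.2.2) h

/-- A cycle of the prism whose vertices have labels in `L` is a hole as soon as every subdivided
edge either lies on it, or is not a chord of it. -/
lemma isHole {x : V} {c : G.Walk x x} (hc : c.IsCycle) (h4 : 4 ≤ c.length) (L : List ℕ)
    (hL : ∀ z ∈ c.support, S.lab z ∈ L) (hlt : ∀ n ∈ L, n < 15)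
    (h01 : S.A01.edges ⊆ c.edges ∨ 6 ∉ L ∧ (2 ≤ S.A01.length ∨ 0 ∉ L ∨ 1 ∉ L))
    (h02 : S.A02.edges ⊆ c.edges ∨ 7 ∉ L ∧ (2 ≤ S.A02.length ∨ 0 ∉ L ∨ 2 ∉ L))
    (h12 : S.A12.edges ⊆ c.edges ∨ 8 ∉ L ∧ (2 ≤ S.A12.length ∨ 1 ∉ L ∨ 2 ∉ L))
    (k01 : S.C01.edges ⊆ c.edges ∨ 9 ∉ L ∧ (2 ≤ S.C01.length ∨ 3 ∉ L ∨ 4 ∉ L))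
    (k02 : S.C02.edges ⊆ c.edges ∨ 10 ∉ L ∧ (2 ≤ S.C02.length ∨ 3 ∉ L ∨ 5 ∉ L))
    (k12 : S.C12.edges ⊆ c.edges ∨ 11 ∉ L ∧ (2 ≤ S.C12.length ∨ 4 ∉ L ∨ 5 ∉ L))
    (r0 : S.R0.edges ⊆ c.edges ∨ 12 ∉ L ∧ (2 ≤ S.R0.length ∨ 0 ∉ L ∨ 3 ∉ L))
    (r1 : S.R1.edges ⊆ c.edges ∨ 13 ∉ L ∧ (2 ≤ S.R1.length ∨ 1 ∉ L ∨ 4 ∉ L))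
    (r2 : S.R2.edges ⊆ c.edges ∨ 14 ∉ L ∧ (2 ≤ S.R2.length ∨ 2 ∉ L ∨ 5 ∉ L)) :
    IsHole G c := by
  refine ⟨hc, h4, fun z hz w hw hzw ↦ ?_⟩
  rcases S.induced z w (hlt _ (hL z hz)) (hlt _ (hL w hw)) hzw with
    h | h | h | h | h | h | h | h | h
  · exact S.mem_edges_of_lab hL S.hA01 S.lab_a0 S.lab_a1 S.lab_A01 h01 hz hw h
  · exact S.mem_edges_of_lab hL S.hA02 S.lab_a0 S.lab_a2 S.lab_A02 h02 hz hw h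
  · exact S.mem_edges_of_lab hL S.hA12 S.lab_a1 S.lab_a2 S.lab_A12 h12 hz hw h
  · exact S.mem_edges_of_lab hL S.hC01 S.lab_c0 S.lab_c1 S.lab_C01 k01 hz hw h
  · exact S.mem_edges_of_lab hL S.hC02 S.lab_c0 S.lab_c2 S.lab_C02 k02 hz hw h
  · exact S.mem_edges_of_lab hL S.hC12 S.lab_c1 S.lab_c2 S.lab_C12 k12 hz hw h
  · exact S.mem_edges_of_lab hL S.hR0 S.lab_a0 S.lab_c0 S.lab_R0 r0 hz hw h
  · exact S.mem_edges_of_lab hL S.hR1 S.lab_a1 S.lab_c1 S.lab_R1 r1 hz hw h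
  · exact S.mem_edges_of_lab hL S.hR2 S.lab_a2 S.lab_c2 S.lab_R2 r2 hz hw h

set_option linter.unusedSimpArgs false

attribute [local grind →] lab_A01 lab_A02 lab_A12 lab_C01 lab_C02 lab_C12 lab_R0 lab_R1 lab_R2

/-- The triangle `a1 a0 a2`. -/
def triangle : G.Walk S.a1 S.a1 := S.A01.reverse.append (S.A02.append S.A12.reverse)

lemma triangle_isCycle : S.triangle.IsCycle := by
  have := S.lengths_pos
  refine S.hA01.reverse.isCycle_append_of_inter
    (S.hA02.append_of_inter S.hA12.reverse fun z h h' ↦ ?_) (fun z h h' ↦ ?_)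
    (.inr (by simp; omega))
  all_goals simp only [Walk.mem_support_append_iff, Walk.support_reverse, List.mem_reverse] at h h'
  all_goals
    simp only [← lab_a0, ← lab_a1, ← lab_a2, ← lab_c0, ← lab_c1, ← lab_c2]
    clear this
    grind

lemma triangle_isHole (h4 : 4 ≤ S.triangle.length) : IsHole G S.triangle := by
  refine S.isHole S.triangle_isCycle h4 [0, 1, 2, 6, 7, 8] ?_ ?_ ?_ ?_ ?_ ?_ ?_ ?_ ?_ ?_ ?_
  · simp only [triangle, Walk.mem_support_append_iff, Walk.support_reverse, List.mem_reverse,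
      List.mem_cons]
    grind
  all_goals simp +contextual [triangle, List.subset_def]

/-- The quadrangle `a1 a2 c2 c1`. -/
def quadrangle : G.Walk S.a1 S.a1 :=
  S.A12.append (S.R2.append (S.C12.reverse.append S.R1.reverse))

lemma quadrangle_isCycle : S.quadrangle.IsCycle := by
  have := S.lengths_pos
  refine S.hA12.isCycle_append_of_inter (S.hR2.append_of_inter
    (S.hC12.reverse.append_of_inter S.hR1.reverse fun z h h' ↦ ?_) fun z h h' ↦ ?_)
    (fun z h h' ↦ ?_) (.inr (by simp; omega))
  all_goals simp only [Walk.mem_support_append_iff, Walk.support_reverse, List.mem_reverse] at h h'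
  all_goals
    simp only [← lab_a0, ← lab_a1, ← lab_a2, ← lab_c0, ← lab_c1, ← lab_c2]
    clear this
    grind

lemma quadrangle_isHole (h4 : 4 ≤ S.quadrangle.length) : IsHole G S.quadrangle := by
  refine S.isHole S.quadrangle_isCycle h4 [1, 2, 4, 5, 8, 11, 13, 14]
    ?_ ?_ ?_ ?_ ?_ ?_ ?_ ?_ ?_ ?_ ?_
  · simp only [quadrangle, Walk.mem_support_append_iff, Walk.support_reverse, List.mem_reverse,
      List.mem_cons]
    grind
  all_goals simp +contextual [quadrangle, List.subset_def]

/-- The hexagon `a0 a2 a1 c1 c2 c0`. -/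
def hexagon : G.Walk S.a0 S.a0 := S.A02.append (S.A12.reverse.append (S.R1.append
  (S.C12.append (S.C02.reverse.append S.R0.reverse))))

lemma hexagon_isCycle : S.hexagon.IsCycle := by
  have := S.lengths_pos
  refine S.hA02.isCycle_append_of_inter (S.hA12.reverse.append_of_inter (S.hR1.append_of_inter
    (S.hC12.append_of_inter (S.hC02.reverse.append_of_inter S.hR0.reverse
    fun z h h' ↦ ?_) fun z h h' ↦ ?_) fun z h h' ↦ ?_) fun z h h' ↦ ?_)
    (fun z h h' ↦ ?_) (.inr (by simp; omega))
  all_goals simp only [Walk.mem_support_append_iff, Walk.support_reverse, List.mem_reverse] at h h'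
  all_goals
    simp only [← lab_a0, ← lab_a1, ← lab_a2, ← lab_c0, ← lab_c1, ← lab_c2]
    clear this
    grind

lemma hexagon_isHole (h4 : 4 ≤ S.hexagon.length) (h : 2 ≤ S.A01.length) (h' : 2 ≤ S.C01.length)
    (h'' : 2 ≤ S.R2.length) : IsHole G S.hexagon := by
  refine S.isHole S.hexagon_isCycle h4 [0, 1, 2, 3, 4, 5, 7, 8, 10, 11, 12, 13]
    ?_ ?_ ?_ ?_ ?_ ?_ ?_ ?_ ?_ ?_ ?_
  · simp only [hexagon, Walk.mem_support_append_iff, Walk.support_reverse, List.mem_reverse,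
      List.mem_cons]
    grind
  all_goals simp +contextual [hexagon, List.subset_def, h, h', h'']

/-- The pentagon `a0 a2 a1 c1 c0`. -/
def pentagon : G.Walk S.a0 S.a0 :=
  S.A02.append (S.A12.reverse.append (S.R1.append (S.C01.reverse.append S.R0.reverse)))

lemma pentagon_isCycle : S.pentagon.IsCycle := by
  have := S.lengths_pos
  refine S.hA02.isCycle_append_of_inter (S.hA12.reverse.append_of_inter (S.hR1.append_of_inter
    (S.hC01.reverse.append_of_inter S.hR0.reverse fun z h h' ↦ ?_) fun z h h' ↦ ?_)
    fun z h h' ↦ ?_) (fun z h h' ↦ ?_) (.inr (by simp; omega))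
  all_goals simp only [Walk.mem_support_append_iff, Walk.support_reverse, List.mem_reverse] at h h'
  all_goals
    simp only [← lab_a0, ← lab_a1, ← lab_a2, ← lab_c0, ← lab_c1, ← lab_c2]
    clear this
    grind

lemma pentagon_isHole (h4 : 4 ≤ S.pentagon.length) (h : 2 ≤ S.A01.length) :
    IsHole G S.pentagon := by
  refine S.isHole S.pentagon_isCycle h4 [0, 1, 2, 3, 4, 7, 8, 9, 12, 13]
    ?_ ?_ ?_ ?_ ?_ ?_ ?_ ?_ ?_ ?_ ?_
  · simp only [pentagon, Walk.mem_support_append_iff, Walk.support_reverse, List.mem_reverse,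
      List.mem_cons]
    grind
  all_goals simp +contextual [pentagon, List.subset_def, h]

/-- The pentagon `a1 a2 c2 c0 c1`. -/
def pentagon' : G.Walk S.a1 S.a1 :=
  S.A12.append (S.R2.append (S.C02.reverse.append (S.C01.append S.R1.reverse)))

lemma pentagon'_isCycle : S.pentagon'.IsCycle := by
  have := S.lengths_pos
  refine S.hA12.isCycle_append_of_inter (S.hR2.append_of_inter (S.hC02.reverse.append_of_inter
    (S.hC01.append_of_inter S.hR1.reverse fun z h h' ↦ ?_) fun z h h' ↦ ?_)
    fun z h h' ↦ ?_) (fun z h h' ↦ ?_) (.inr (by simp; omega))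
  all_goals simp only [Walk.mem_support_append_iff, Walk.support_reverse, List.mem_reverse] at h h'
  all_goals
    simp only [← lab_a0, ← lab_a1, ← lab_a2, ← lab_c0, ← lab_c1, ← lab_c2]
    clear this
    grind

lemma pentagon'_isHole (h4 : 4 ≤ S.pentagon'.length) (h : 2 ≤ S.C12.length) :
    IsHole G S.pentagon' := by
  refine S.isHole S.pentagon'_isCycle h4 [1, 2, 3, 4, 5, 8, 9, 10, 13, 14]
    ?_ ?_ ?_ ?_ ?_ ?_ ?_ ?_ ?_ ?_ ?_
  · simp only [pentagon', Walk.mem_support_append_iff, Walk.support_reverse, List.mem_reverse,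
      List.mem_cons]
    grind
  all_goals simp +contextual [pentagon', List.subset_def, h]

/-- The relabelling that exchanges the indices `1` and `2`. -/
def swapLab : ℕ → ℕ
  | 1 => 2 | 2 => 1 | 4 => 5 | 5 => 4 | 6 => 7 | 7 => 6
  | 9 => 10 | 10 => 9 | 13 => 14 | 14 => 13 | n => n

lemma swapLab_swapLab (n : ℕ) : swapLab (swapLab n) = n := by
  unfold swapLab
  grind

lemma swapLab_eq_iff {n k : ℕ} : swapLab n = k ↔ n = swapLab k :=
  ⟨fun h ↦ by rw [← h, swapLab_swapLab], fun h ↦ by rw [h, swapLab_swapLab]⟩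

lemma lt_of_swapLab_lt {n : ℕ} (h : swapLab n < 15) : n < 15 := by
  unfold swapLab at h
  grind

/-- The mirror image of a prism, with the indices `1` and `2` exchanged. -/
def swap : InducedPrism G where
  a0 := S.a0
  a1 := S.a2
  a2 := S.a1
  c0 := S.c0
  c1 := S.c2
  c2 := S.c1
  A01 := S.A02
  A02 := S.A01
  A12 := S.A12.reverse
  C01 := S.C02
  C02 := S.C01
  C12 := S.C12.reverse
  R0 := S.R0
  R1 := S.R2
  R2 := S.R1
  hA01 := S.hA02
  hA02 := S.hA01
  hA12 := S.hA12.reverse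
  hC01 := S.hC02
  hC02 := S.hC01
  hC12 := S.hC12.reverse
  hR0 := S.hR0
  hR1 := S.hR2
  hR2 := S.hR1
  lab z := swapLab (S.lab z)
  lab_a0 z := by simp only [swapLab_eq_iff]; exact S.lab_a0 z
  lab_a1 z := by simp only [swapLab_eq_iff]; exact S.lab_a2 z
  lab_a2 z := by simp only [swapLab_eq_iff]; exact S.lab_a1 z
  lab_c0 z := by simp only [swapLab_eq_iff]; exact S.lab_c0 z
  lab_c1 z := by simp only [swapLab_eq_iff]; exact S.lab_c2 z
  lab_c2 z := by simp only [swapLab_eq_iff]; exact S.lab_c1 z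
  lab_A01 z := by simp only [swapLab_eq_iff]; exact S.lab_A02 z
  lab_A02 z := by simp only [swapLab_eq_iff]; exact S.lab_A01 z
  lab_A12 z hz := by
    simp only [swapLab_eq_iff]
    exact or_left_comm.1 (S.lab_A12 z (by simpa using hz))
  lab_C01 z := by simp only [swapLab_eq_iff]; exact S.lab_C02 z
  lab_C02 z := by simp only [swapLab_eq_iff]; exact S.lab_C01 z
  lab_C12 z hz := by
    simp only [swapLab_eq_iff]
    exact or_left_comm.1 (S.lab_C12 z (by simpa using hz))
  lab_R0 z := by simp only [swapLab_eq_iff]; exact S.lab_R0 z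
  lab_R1 z := by simp only [swapLab_eq_iff]; exact S.lab_R2 z
  lab_R2 z := by simp only [swapLab_eq_iff]; exact S.lab_R1 z
  induced z w hz hw h := by
    have := S.induced z w (lt_of_swapLab_lt hz) (lt_of_swapLab_lt hw) h
    simp only [Walk.edges_reverse, List.mem_reverse]
    tauto

lemma lengths_eq_aux {ℓ a b t p l r u w : ℕ} (hℓ : 5 ≤ ℓ) (hr : 1 ≤ r) (ha : 1 ≤ a) (hb : 1 ≤ b)
    (hu : 1 ≤ u) (hw : 1 ≤ w) (hl : l = a + u) (hp : p = b + w)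
    (h : p + l + r = 2 * ℓ + 1) (hle : l ≤ p) (hleℓ : p ≤ ℓ)
    (g1 : 2 * ℓ + 1 ≤ a + b + t) (g2 : 2 * ℓ + 1 ≤ t + w + r + u)
    (f1 : ∀ k, a + b + t = 2 * k + 1 → k = ℓ)
    (f2 : ∀ k, t + w + r + u = 2 * k + 1 → k = ℓ)
    (f3 : 2 ≤ a → 2 ≤ w → ∀ k, b + t + u + r + l + r = 2 * k + 1 → k = ℓ)
    (f3' : 2 ≤ b → 2 ≤ u → ∀ k, a + t + w + r + p + r = 2 * k + 1 → k = ℓ)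
    (f4 : 2 ≤ a → ∀ k, b + t + u + p + r = 2 * k + 1 → k = ℓ)
    (f4' : 2 ≤ b → ∀ k, a + t + w + l + r = 2 * k + 1 → k = ℓ)
    (f5 : 2 ≤ r → ∀ k, t + w + l + p + u = 2 * k + 1 → k = ℓ) :
    r = 1 ∧ p = ℓ ∧ l = ℓ ∧ a = 1 ∧ b = 1 ∧ t = 2 * ℓ - 1 ∧ Odd (a + b + t) := by
  obtain ⟨m, hm | hm⟩ := Nat.even_or_odd' (a + b + t)
  · exfalso
    have f2 := f2 (m - a - b + ℓ) (by omega)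
    have ha' : a = 1 := by
      by_contra h
      have := f4 (by omega) (m - a + ℓ) (by omega)
      omega
    have hb' : b = 1 := by
      by_contra h
      have := f4' (by omega) (m - b + ℓ) (by omega)
      omega
    omega
  obtain rfl := f1 m hm
  have hr' : r = 1 := by
    by_contra h
    have := f5 (by omega) (m + u + w) (by omega)
    omega
  have h1 : a = 1 ∨ w = 1 := by
    by_contra! h
    have := f3 (by omega) (by omega) (m + u + 1) (by omega)
    omega
  have h2 : b = 1 ∨ u = 1 := by
    by_contra! h
    have := f3' (by omega) (by omega) (m + w + 1) (by omega)
    omega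
  exact ⟨hr', by omega, by omega, by omega, by omega, by omega, m, hm⟩

/-- Let a prism arise from an odd `K₄`-subdivision with arris lengths `R0`, `C02 ≤ C01` by
joining interior vertices of two consecutive arrises. Then its lengths are determined. -/
theorem lengths_eq (hG : InGFamily ℓ G) (hℓ : 5 ≤ ℓ)
    (hC12 : S.C12.length = S.R0.length)
    (hC02 : S.C02.length = S.A01.length + S.R1.length)
    (hC01 : S.C01.length = S.A02.length + S.R2.length)
    (hC : S.C01.length + S.C02.length + S.R0.length = 2 * ℓ + 1)
    (hle : S.C02.length ≤ S.C01.length) (hleℓ : S.C01.length ≤ ℓ) :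
    S.R0.length = 1 ∧ S.C01.length = ℓ ∧ S.C02.length = ℓ ∧ S.A01.length = 1 ∧
      S.A02.length = 1 ∧ S.A12.length = 2 * ℓ - 1 ∧ IsOddHole G S.triangle := by
  obtain ⟨p1, p2, p3, p4, p5, -, p7, p8, p9⟩ := S.lengths_pos
  have key {v : V} {c : G.Walk v v} (hc : 4 ≤ c.length → IsHole G c) {n : ℕ} (hn : c.length = n)
      (hn4 : 4 ≤ n) (k : ℕ) (hk : n = 2 * k + 1) : k = ℓ := by
    have := hG.2 v c ⟨hc (by omega), k, by omega⟩
    omega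
  have e1 : S.triangle.length = S.A01.length + S.A02.length + S.A12.length := by
    simp [triangle]; omega
  have e2 : S.quadrangle.length = S.A12.length + S.R2.length + S.R0.length + S.R1.length := by
    simp [quadrangle, hC12]; omega
  obtain ⟨h1, h2, h3, h4, h5, h6, h7⟩ := lengths_eq_aux hℓ p7 p1 p2 p8 p9 hC02 hC01 hC hle hleℓ
    (e1 ▸ hG.le_length S.triangle_isCycle) (e2 ▸ hG.le_length S.quadrangle_isCycle)
    (key S.triangle_isHole e1 (by have := hG.le_length S.triangle_isCycle; omega))
    (key S.quadrangle_isHole e2 (by omega))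
    (fun ha hw ↦ key (S.hexagon_isHole · ha (by omega) hw) (by simp [hexagon, hC12]; omega)
      (by omega))
    (fun ha hw ↦ key (S.swap.hexagon_isHole · ha (by simp only [swap]; omega) hw)
      (by simp [hexagon, swap, hC12]; omega) (by omega))
    (fun ha ↦ key (S.pentagon_isHole · ha) (by simp [pentagon]; omega) (by omega))
    (fun ha ↦ key (S.swap.pentagon_isHole · ha) (by simp [pentagon, swap]; omega) (by omega))
    (fun hr ↦ key (S.pentagon'_isHole · (by omega)) (by simp [pentagon']; omega) (by omega))
  exact ⟨h1, h2, h3, h4, h5, h6, S.triangle_isHole (by omega), e1 ▸ h7⟩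

end InducedPrism

lemma IsOddHole.exists_adj_of_length_eq_one {u v w : V} {p : G.Walk u v} {q : G.Walk v w}
    {r : G.Walk w u} (hp : p.length = 1) (hq : q.length = 1)
    (h : IsOddHole G (p.append (q.append r))) :
    ∃ (h1 : G.Adj u v) (h2 : G.Adj v w), IsOddHole G (Walk.cons h1 (Walk.cons h2 r)) := by
  cases p with
  | nil => simp at hp
  | cons hp' p => cases p with
    | nil => cases q with
      | nil => simp at hq
      | cons hq' q => cases q with
        | nil => exact ⟨hp', hq', h⟩
        | cons _ _ => simp at hq
    | cons _ _ => simp at hp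

end Prism

section OddK4

variable {G : SimpleGraph V} {ℓ : ℕ}

lemma mem_support_iff_interiorL {a b z : V} {p : G.Walk a b} :
    z ∈ p.support ↔ z = a ∨ z = b ∨ z ∈ interiorL p := by
  cases p with
  | nil => simp [interiorL]
  | cons h q =>
    have : q.support = q.support.dropLast ++ [b] := by
      conv_lhs => rw [← List.dropLast_append_getLast q.support_ne_nil, Walk.getLast_support]
    simp only [interiorL, Walk.support_cons, List.mem_cons, List.tail_cons]
    conv_lhs => rw [this]
    simp only [List.mem_append, List.mem_singleton]
    tauto

/-- If the path `X` from `a` to `z` and the path `Y` from `c` to `w` are disjoint and linked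
by a path `M` from `a` to `c`, then an edge `zw` closes a cycle. -/
lemma InGFamily.le_length_of_adj (hG : InGFamily ℓ G) {a c z w : V} {X : G.Walk a z}
    {Y : G.Walk c w} {M : G.Walk a c} (hX : X.IsPath) (hY : Y.IsPath) (hM : M.IsPath)
    (hXY : ∀ t ∈ X.support, t ∉ Y.support) (hXM : ∀ t ∈ X.support, t ∈ M.support → t = a)
    (hYM : ∀ t ∈ Y.support, t ∈ M.support → t = c) (hza : z ≠ a) (h : G.Adj z w) :
    2 * ℓ + 1 ≤ X.length + M.length + Y.length + 1 := by
  have hp : (X.reverse.append (M.append Y)).IsPath := by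
    refine hX.reverse.append_of_inter (hM.append_of_inter hY fun t h h' ↦ hYM t h' h)
      fun t h h' ↦ ?_
    rw [Walk.support_reverse, List.mem_reverse] at h
    rw [Walk.mem_support_append_iff] at h'
    exact h'.elim (hXM t h) fun h' ↦ absurd h' (hXY t h)
  have hX1 : X.length ≠ 0 := fun h ↦ hza (Walk.eq_of_length_eq_zero h).symm
  have hM1 : M.length ≠ 0 := fun h ↦ by
    obtain rfl := Walk.eq_of_length_eq_zero h
    exact hXY _ X.start_mem_support Y.start_mem_support
  have := hG.le_length_add_one hp h.symm (by simp; omega)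
  simp at this
  omega

/-- Opposite arrises of a `K₄`-subdivision are not joined by an edge between
their interiors. -/
lemma InGFamily.not_adj_of_opposite (hG : InGFamily ℓ G) (hℓ : 5 ≤ ℓ) {a b c d z w : V}
    {X : G.Walk a b} {Y : G.Walk c d} {M₁ : G.Walk a c} {M₂ : G.Walk a d} {M₃ : G.Walk b c}
    {M₄ : G.Walk b d} (hX : X.IsPath) (hY : Y.IsPath) (h₁ : M₁.IsPath) (h₂ : M₂.IsPath)
    (h₃ : M₃.IsPath) (h₄ : M₄.IsPath) (hXY : ∀ t ∈ X.support, t ∉ Y.support)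
    (hX₁ : ∀ t ∈ X.support, t ∈ M₁.support → t = a)
    (hX₂ : ∀ t ∈ X.support, t ∈ M₂.support → t = a)
    (hX₃ : ∀ t ∈ X.support, t ∈ M₃.support → t = b)
    (hX₄ : ∀ t ∈ X.support, t ∈ M₄.support → t = b)
    (hY₁ : ∀ t ∈ Y.support, t ∈ M₁.support → t = c)
    (hY₂ : ∀ t ∈ Y.support, t ∈ M₂.support → t = d)
    (hY₃ : ∀ t ∈ Y.support, t ∈ M₃.support → t = c)
    (hY₄ : ∀ t ∈ Y.support, t ∈ M₄.support → t = d)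
    (hlen : X.length = Y.length) (h₁₄ : M₁.length = M₄.length) (h₂₃ : M₂.length = M₃.length)
    (hsum : X.length + M₁.length + M₂.length = 2 * ℓ + 1) (hle : X.length ≤ ℓ)
    (hz : z ∈ X.support) (hza : z ≠ a) (hzb : z ≠ b) (hw : w ∈ Y.support) : ¬ G.Adj z w := by
  intro h
  obtain ⟨X₁, X₂, rfl⟩ := Walk.mem_support_iff_exists_append.1 hz
  obtain ⟨Y₁, Y₂, rfl⟩ := Walk.mem_support_iff_exists_append.1 hw
  simp only [Walk.mem_support_append_iff] at *
  have hX1 := hX.of_append_left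
  have hX2 := hX.of_append_right.reverse
  have hY1 := hY.of_append_left
  have hY2 := hY.of_append_right.reverse
  have k₁ := hG.le_length_of_adj hX1 hY1 h₁ (by grind) (by grind) (by grind) hza h
  have k₂ := hG.le_length_of_adj hX1 hY2 h₂ (by simp; grind) (by grind) (by simp; grind) hza h
  have k₃ := hG.le_length_of_adj hX2 hY1 h₃ (by simp; grind) (by simp; grind) (by grind) hzb h
  have k₄ := hG.le_length_of_adj hX2 hY2 h₄ (by simp; grind) (by simp; grind) (by simp; grind) hzb h
  simp only [Walk.length_append, Walk.length_reverse] at *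
  omega

namespace OddK4

variable (K : OddK4 G)

open Classical in
/-- A labelling that tells the branch vertices (labels `0` to `3`), the interiors of the arrises
(labels `4` to `9`), and the other vertices apart. -/
noncomputable def lab (z : V) : ℕ :=
  if z = K.u1 then 0 else if z = K.u2 then 1 else if z = K.u3 then 2 else if z = K.u4 then 3 else
  if z ∈ interiorL K.P1 then 4 else if z ∈ interiorL K.P2 then 5 else
  if z ∈ interiorL K.Q1 then 6 else if z ∈ interiorL K.Q2 then 7 else
  if z ∈ interiorL K.L1 then 8 else if z ∈ interiorL K.L2 then 9 else 10

lemma lab_iff (z : V) : (K.lab z = 0 ↔ z = K.u1) ∧ (K.lab z = 1 ↔ z = K.u2) ∧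
    (K.lab z = 2 ↔ z = K.u3) ∧ (K.lab z = 3 ↔ z = K.u4) ∧
    (K.lab z = 4 ↔ z ∈ interiorL K.P1) ∧ (K.lab z = 5 ↔ z ∈ interiorL K.P2) ∧
    (K.lab z = 6 ↔ z ∈ interiorL K.Q1) ∧ (K.lab z = 7 ↔ z ∈ interiorL K.Q2) ∧
    (K.lab z = 8 ↔ z ∈ interiorL K.L1) ∧ (K.lab z = 9 ↔ z ∈ interiorL K.L2) := by
  have h1 := K.hnodup
  have h2 := K.hdisj
  have h3 := K.hbranch z
  simp only [List.nodup_cons, List.mem_cons, List.not_mem_nil, List.pairwise_cons, forall_eq_or_imp,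
    List.Disjoint, List.mem_append] at h1 h2 h3
  obtain ⟨⟨a1, a2, a3, a4, a5, -⟩, ⟨b1, b2, b3, b4, -⟩, ⟨c1, c2, c3, -⟩, ⟨d1, d2, -⟩,
    ⟨e1, -⟩, -⟩ := h2
  have := @a1 z; have := @a2 z; have := @a3 z; have := @a4 z; have := @a5 z
  have := @b1 z; have := @b2 z; have := @b3 z; have := @b4 z
  have := @c1 z; have := @c2 z; have := @c3 z
  have := @d1 z; have := @d2 z; have := @e1 z
  clear a1 a2 a3 a4 a5 b1 b2 b3 b4 c1 c2 c3 d1 d2 e1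
  unfold lab
  refine ⟨?_, ?_, ?_, ?_, ?_, ?_, ?_, ?_, ?_, ?_⟩ <;> grind (splits := 20)

lemma lab_support (z : V) :
    (z ∈ K.P1.support ↔ K.lab z = 0 ∨ K.lab z = 1 ∨ K.lab z = 4) ∧
    (z ∈ K.P2.support ↔ K.lab z = 2 ∨ K.lab z = 3 ∨ K.lab z = 5) ∧
    (z ∈ K.Q1.support ↔ K.lab z = 1 ∨ K.lab z = 2 ∨ K.lab z = 6) ∧
    (z ∈ K.Q2.support ↔ K.lab z = 0 ∨ K.lab z = 3 ∨ K.lab z = 7) ∧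
    (z ∈ K.L1.support ↔ K.lab z = 0 ∨ K.lab z = 2 ∨ K.lab z = 8) ∧
    (z ∈ K.L2.support ↔ K.lab z = 1 ∨ K.lab z = 3 ∨ K.lab z = 9) := by
  obtain ⟨h0, h1, h2, h3, h4, h5, h6, h7, h8, h9⟩ := K.lab_iff z
  simp only [mem_support_iff_interiorL, h0, h1, h2, h3, h4, h5, h6, h7, h8, h9, and_self]

lemma mem_verts_iff (z : V) : z ∈ K.verts ↔ K.lab z < 10 := by
  obtain ⟨h1, h2, h3, h4, h5, h6⟩ := K.lab_support z
  simp only [verts, toSubgraph, Subgraph.verts_sup, Set.mem_union, Walk.mem_verts_toSubgraph,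
    h1, h2, h3, h4, h5, h6]
  omega

lemma lengths (hG : InGFamily ℓ G) :
    K.P2.length = K.P1.length ∧ K.Q2.length = K.Q1.length ∧ K.L2.length = K.L1.length ∧
      K.P1.length + K.Q1.length + K.L1.length = 2 * ℓ + 1 := by
  have h1 := hG.2 _ _ K.face1
  have h2 := hG.2 _ _ K.face2
  have h3 := hG.2 _ _ K.face3
  have h4 := hG.2 _ _ K.face4
  simp only [Walk.length_append, Walk.length_reverse] at h1 h2 h3 h4
  omega

lemma length_P1_le (hG : InGFamily ℓ G) : K.P1.length ≤ ℓ := by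
  have hc : (K.Q1.append (K.L1.reverse.append (K.Q2.append K.L2.reverse))).IsCycle := by
    refine K.hQ1.isCycle_append_of_inter (K.hL1.reverse.append_of_inter
      (K.hQ2.append_of_inter K.hL2.reverse fun z h h' ↦ ?_) fun z h h' ↦ ?_) (fun z h h' ↦ ?_) ?_
    · simp only [Walk.support_reverse, List.mem_reverse] at h h'
      grind [K.lab_support z, K.lab_iff z]
    · simp only [Walk.mem_support_append_iff, Walk.support_reverse, List.mem_reverse] at h h'
      grind [K.lab_support z, K.lab_iff z]
    · simp only [Walk.mem_support_append_iff, Walk.support_reverse, List.mem_reverse] at h h'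
      grind [K.lab_support z, K.lab_iff z]
    · have h := K.hnodup
      have h1 : K.L1.length ≠ 0 := fun h0 ↦ by simp [Walk.eq_of_length_eq_zero h0] at h
      have h2 : K.L2.length ≠ 0 := fun h0 ↦ by simp [Walk.eq_of_length_eq_zero h0] at h
      simp only [Walk.length_append, Walk.length_reverse]
      omega
  have := hG.le_length hc
  have := K.lengths hG
  simp only [Walk.length_append, Walk.length_reverse] at *
  omega

lemma mem_edges_of_adj (hG : InGFamily ℓ G) (hℓ : 5 ≤ ℓ) (hlong : K.longestPair) {z w : V}
    (hz : z ∈ K.verts) (hw : w ∈ K.verts) (h : G.Adj z w) :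
    s(z, w) ∈ K.P1.edges ∨ s(z, w) ∈ K.P2.edges ∨ s(z, w) ∈ K.Q1.edges ∨
      s(z, w) ∈ K.Q2.edges ∨ s(z, w) ∈ K.L1.edges ∨ s(z, w) ∈ K.L2.edges := by
  wlog hlt : K.lab z ≤ K.lab w generalizing z w
  · simpa only [Sym2.eq_swap] using this hw hz h.symm (by omega)
  rw [mem_verts_iff] at hz hw
  have f1 := fun hz hw ↦ K.face1.1.2.2 z hz w hw h
  have f2 := fun hz hw ↦ K.face2.1.2.2 z hz w hw h
  have f3 := fun hz hw ↦ K.face3.1.2.2 z hz w hw h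
  have f4 := fun hz hw ↦ K.face4.1.2.2 z hz w hw h
  simp only [Walk.mem_support_append_iff, Walk.support_reverse, List.mem_reverse, Walk.edges_append,
    Walk.edges_reverse, List.mem_append] at f1 f2 f3 f4
  have sz := K.lab_support z
  have sw := K.lab_support w
  have hlen := K.lengths hG
  have hle := K.length_P1_le hG
  obtain ⟨q1, q2, q3, q4, -⟩ := hlong
  have n1 : ¬ (K.lab z = 4 ∧ K.lab w = 5) := fun ⟨hz, hw⟩ ↦ by
    refine hG.not_adj_of_opposite hℓ K.hP1 K.hP2 K.hL1 K.hQ2 K.hQ1 K.hL2 ?_ ?_ ?_ ?_ ?_ ?_ ?_ ?_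
      ?_ ?_ ?_ ?_ ?_ ?_ (z := z) (w := w) ?_ ?_ ?_ ?_ h
    iterate 9 intro t; grind [K.lab_support t, K.lab_iff t, Walk.support_reverse]
    iterate 5 grind [Walk.length_reverse]
    all_goals grind [K.lab_support z, K.lab_iff z]
  have n2 : ¬ (K.lab z = 6 ∧ K.lab w = 7) := fun ⟨hz, hw⟩ ↦ by
    refine hG.not_adj_of_opposite hℓ K.hQ1 K.hQ2 K.hP1.reverse K.hL2 K.hL1.reverse K.hP2
      ?_ ?_ ?_ ?_ ?_ ?_ ?_ ?_ ?_ ?_ ?_ ?_ ?_ ?_ (z := z) (w := w) ?_ ?_ ?_ ?_ h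
    iterate 9 intro t; grind [K.lab_support t, K.lab_iff t, Walk.support_reverse]
    iterate 5 grind [Walk.length_reverse]
    all_goals grind [K.lab_support z, K.lab_iff z]
  have n3 : ¬ (K.lab z = 8 ∧ K.lab w = 9) := fun ⟨hz, hw⟩ ↦ by
    refine hG.not_adj_of_opposite hℓ K.hL1 K.hL2 K.hP1 K.hQ2 K.hQ1.reverse K.hP2
      ?_ ?_ ?_ ?_ ?_ ?_ ?_ ?_ ?_ ?_ ?_ ?_ ?_ ?_ (z := z) (w := w) ?_ ?_ ?_ ?_ h
    iterate 9 intro t; grind [K.lab_support t, K.lab_iff t, Walk.support_reverse]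
    iterate 5 grind [Walk.length_reverse]
    all_goals grind [K.lab_support z, K.lab_iff z]
  grind

end OddK4

end OddK4

lemma SimpleGraph.Walk.IsPath.eq_of_mem_support_append {G : SimpleGraph V} {u v w z : V}
    {p : G.Walk u v} {q : G.Walk v w} (h : (p.append q).IsPath) (hp : z ∈ p.support)
    (hq : z ∈ q.support) : z = v := by
  rw [Walk.isPath_def, Walk.support_append, List.nodup_append'] at h
  rw [Walk.mem_support_iff] at hq
  exact hq.resolve_right (h.2.2 hp)

namespace OddK4

variable {G : SimpleGraph V} {ℓ : ℕ} (K : OddK4 G)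

open Classical in
lemma exists_lab {x y : V} (hx : K.lab x = 8) (hy : K.lab y = 5) (X Y P : V → Prop) :
    ∃ lab : V → ℕ, ∀ z, (lab z = 0 ↔ K.lab z = 2) ∧ (lab z = 1 ↔ z = x) ∧ (lab z = 2 ↔ z = y) ∧
      (lab z = 3 ↔ K.lab z = 1) ∧ (lab z = 4 ↔ K.lab z = 0) ∧ (lab z = 5 ↔ K.lab z = 3) ∧
      (K.lab z = 4 → lab z = 9) ∧ (K.lab z = 9 → lab z = 10) ∧ (K.lab z = 7 → lab z = 11) ∧
      (K.lab z = 6 → lab z = 12) ∧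
      (K.lab z = 8 → z ≠ x → (X z → lab z = 6) ∧ (¬ X z → lab z = 13)) ∧
      (K.lab z = 5 → z ≠ y → (Y z → lab z = 7) ∧ (¬ Y z → lab z = 14)) ∧
      (10 ≤ K.lab z → (P z → lab z = 8) ∧ (¬ P z → lab z = 15)) := by
  refine ⟨fun z ↦ if z = x then 1 else if z = y then 2 else if K.lab z = 2 then 0 else
    if K.lab z = 1 then 3 else if K.lab z = 0 then 4 else if K.lab z = 3 then 5 else
    if K.lab z = 8 then (if X z then 6 else 13) else
    if K.lab z = 5 then (if Y z then 7 else 14) else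
    if K.lab z = 4 then 9 else if K.lab z = 9 then 10 else if K.lab z = 7 then 11 else
    if K.lab z = 6 then 12 else if P z then 8 else 15, fun z ↦ ?_⟩
  by_cases hzx : z = x
  · simp [hzx, hx, show x ≠ y from fun h ↦ by simp [h, hy] at hx]
  by_cases hzy : z = y
  · simp [hzy, hy, show y ≠ x from fun h ↦ by simp [h, hx] at hy]
  simp only [hzx, hzy, if_false]
  clear hx hy
  generalize K.lab z = n
  by_cases h8 : n = 8
  · subst h8
    by_cases h : X z <;> simp [h]
  by_cases h5 : n = 5
  · subst h5
    by_cases h : Y z <;> simp [h]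
  by_cases h : P z <;> simp only [h, h8, h5, if_false] <;> split_ifs <;> simp <;> omega

/-- An odd `K₄`-subdivision, together with an induced path `P'` that links an interior vertex `x`
of `L1` with an interior vertex `y` of `P2`, is an induced prism, whose lengths are determined. -/
lemma lengths_eq_of_link (hG : InGFamily ℓ G) (hℓ : 5 ≤ ℓ) (hlong : K.longestPair) {x y : V}
    {L₁ : G.Walk K.u1 x} {L₃ : G.Walk x K.u3} {P₃ : G.Walk K.u3 y} {P₄ : G.Walk y K.u4}
    (hL : K.L1 = L₁.append L₃) (hP : K.P2 = P₃.append P₄)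
    (hx : x ∈ interiorL K.L1) (hy : y ∈ interiorL K.P2) {P' : G.Walk x y} (hP' : P'.IsPath)
    (hdisj : ∀ z ∈ P'.support, z ∈ K.verts → z = x ∨ z = y)
    (hind : ∀ z ∈ P'.support, ∀ w, w ∈ P'.support ∨ w ∈ K.verts → G.Adj z w →
      s(z, w) ∈ P'.edges ∨ z ∈ K.verts ∧ w ∈ K.verts) :
    K.Q1.length = 1 ∧ K.P1.length = ℓ ∧ K.L1.length = ℓ ∧ L₃.length = 1 ∧ P₃.length = 1 ∧
      P'.length = 2 * ℓ - 1 ∧ IsOddHole G (L₃.append (P₃.append P'.reverse)) := by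
  have hx' : K.lab x = 8 := (K.lab_iff x).2.2.2.2.2.2.2.2.1.2 hx
  have hy' : K.lab y = 5 := (K.lab_iff y).2.2.2.2.2.1.2 hy
  have hLpath : (L₁.append L₃).IsPath := hL ▸ K.hL1
  have hPpath : (P₃.append P₄).IsPath := hP ▸ K.hP2
  have hsupp (z : V) := K.lab_support z
  have hiff (z : V) := K.lab_iff z
  have hv (z : V) := K.mem_verts_iff z
  have hL₃ (z : V) (h : z ∈ L₃.support) : K.lab z = 2 ∨ K.lab z = 8 := by
    have h1 : z ∈ K.L1.support := by rw [hL]; simp [h]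
    have h2 : z = K.u1 → z = x := fun e ↦
      hLpath.eq_of_mem_support_append (e ▸ L₁.start_mem_support) h
    grind
  have hL₁ (z : V) (h : z ∈ L₁.support) :
      K.lab z = 0 ∨ K.lab z = 8 ∧ (z ∈ L₃.support → z = x) := by
    have h1 : z ∈ K.L1.support := by rw [hL]; simp [h]
    have h2 := hLpath.eq_of_mem_support_append h
    have h3 : z = K.u3 → z = x := fun e ↦ h2 (e ▸ L₃.end_mem_support)
    grind
  have hP₃ (z : V) (h : z ∈ P₃.support) : K.lab z = 2 ∨ K.lab z = 5 := by
    have h1 : z ∈ K.P2.support := by rw [hP]; simp [h]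
    have h2 : z = K.u4 → z = y := fun e ↦
      hPpath.eq_of_mem_support_append h (e ▸ P₄.end_mem_support)
    grind
  have hP₄ (z : V) (h : z ∈ P₄.support) :
      K.lab z = 3 ∨ K.lab z = 5 ∧ (z ∈ P₃.support → z = y) := by
    have h1 : z ∈ K.P2.support := by rw [hP]; simp [h]
    have h2 := fun h' ↦ hPpath.eq_of_mem_support_append h' h
    have h3 : z = K.u3 → z = y := fun e ↦ h2 (e ▸ P₃.start_mem_support)
    grind
  obtain ⟨lab, hlab⟩ := K.exists_lab hx' hy' (· ∈ L₃.support) (· ∈ P₃.support) (· ∈ P'.support)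
  have hne (z : V) : (z = x → K.lab z = 8) ∧ (z = y → K.lab z = 5) :=
    ⟨fun h ↦ h ▸ hx', fun h ↦ h ▸ hy'⟩
  let S : InducedPrism G :=
  { a0 := K.u3
    a1 := x
    a2 := y
    c0 := K.u2
    c1 := K.u1
    c2 := K.u4
    A01 := L₃.reverse
    A02 := P₃
    A12 := P'
    C01 := K.P1.reverse
    C02 := K.L2
    C12 := K.Q2
    R0 := K.Q1.reverse
    R1 := L₁.reverse
    R2 := P₄
    hA01 := hLpath.of_append_right.reverse
    hA02 := hPpath.of_append_left
    hA12 := hP'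
    hC01 := K.hP1.reverse
    hC02 := K.hL2
    hC12 := K.hQ2
    hR0 := K.hQ1.reverse
    hR1 := hLpath.of_append_left.reverse
    hR2 := hPpath.of_append_right
    lab := lab
    lab_a0 z := (hlab z).1.trans (hiff z).2.2.1
    lab_a1 z := (hlab z).2.1
    lab_a2 z := (hlab z).2.2.1
    lab_c0 z := (hlab z).2.2.2.1.trans (hiff z).2.1
    lab_c1 z := (hlab z).2.2.2.2.1.trans (hiff z).1
    lab_c2 z := (hlab z).2.2.2.2.2.1.trans (hiff z).2.2.2.1
    lab_A01 z hz := by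
      rw [Walk.support_reverse, List.mem_reverse] at hz
      have h1 := hL₃ z hz
      have h2 := hlab z
      have h3 := hne z
      clear * - hz h1 h2 h3
      grind
    lab_A02 z hz := by
      have h1 := hP₃ z hz
      have h2 := hlab z
      have h3 := hne z
      clear * - hz h1 h2 h3
      grind
    lab_A12 z hz := by
      have h1 := hdisj z hz
      have h2 := hlab z
      rw [hv] at h1
      clear * - h1 h2 hz
      grind
    lab_C01 z hz := by
      have h1 := (hsupp z).1.1 (by simpa using hz)
      have h2 := hlab z
      have h3 := hne z
      clear * - h1 h2 h3
      grind
    lab_C02 z hz := by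
      have h1 := (hsupp z).2.2.2.2.2.1 (by simpa using hz)
      have h2 := hlab z
      have h3 := hne z
      clear * - h1 h2 h3
      grind
    lab_C12 z hz := by
      have h1 := (hsupp z).2.2.2.1.1 (by simpa using hz)
      have h2 := hlab z
      have h3 := hne z
      clear * - h1 h2 h3
      grind
    lab_R0 z hz := by
      have h1 := (hsupp z).2.2.1.1 (by simpa using hz)
      have h2 := hlab z
      have h3 := hne z
      clear * - h1 h2 h3
      grind
    lab_R1 z hz := by
      have h1 := hL₁ z (by simpa using hz)
      have h2 := hlab z
      have h3 := hne z
      clear * - h1 h2 h3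
      grind
    lab_R2 z hz := by
      have h1 := hP₄ z hz
      have h2 := hlab z
      have h3 := hne z
      clear * - h1 h2 h3
      grind
    induced z w hz hw h := by
      have key (t : V) (ht : lab t < 15) : t ∈ P'.support ∨ t ∈ K.verts := by
        have h2 := hlab t
        rw [hv]
        clear * - ht h2
        grind
      have : s(z, w) ∈ P'.edges ∨ z ∈ K.verts ∧ w ∈ K.verts := by
        rcases key z hz with hz' | hz'
        · exact hind z hz' w (key w hw) h
        rcases key w hw with hw' | hw'
        · exact Sym2.eq_swap (a := z) ▸ (hind w hw' z (.inr hz') h.symm).imp_right And.symm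
        · exact .inr ⟨hz', hw'⟩
      simp only [Walk.edges_reverse, List.mem_reverse]
      rcases this with he | ⟨hz', hw'⟩
      · simp only [he, true_or, or_true]
      · have := K.mem_edges_of_adj hG hℓ hlong hz' hw' h
        rw [hL, hP, Walk.edges_append, Walk.edges_append, List.mem_append, List.mem_append] at this
        clear * - this
        grind }
  have hlen := K.lengths hG
  have hle := K.length_P1_le hG
  have hlong := hlong.2.2.1
  have hL' := congrArg Walk.length hL
  have hP'' := congrArg Walk.length hP
  rw [Walk.length_append] at hL' hP''
  have := S.lengths_eq hG hℓ (by simp [S]; omega) (by simp [S]; omega) (by simp [S]; omega)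
    (by simp [S]; omega) (by simp [S]; omega) (by simp [S]; omega)
  simp only [S, InducedPrism.triangle, Walk.reverse_reverse, Walk.length_reverse] at this
  obtain ⟨h1, h2, h3, h4, h5, h6, h7⟩ := this
  exact ⟨h1, h2, by omega, h4, h5, h6, h7⟩

end OddK4

lemma SimpleGraph.Walk.mem_edges_of_length_eq_one {G : SimpleGraph V} {u v : V} {p : G.Walk u v}
    (h : p.length = 1) : s(u, v) ∈ p.edges := by
  cases p with
  | nil => simp at h
  | cons _ q => cases q with
    | nil => simp
    | cons _ _ => simp at h

/-- Claim 3.4: in the setup of the proof of Theorem 1.2, if `x`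
is an internal vertex of `L1`, then `|Q1| = 1`, `|P1| = |L1| = ℓ`, `|P'| = 2ℓ−1`,
the edges `xu3` and `yu3` belong to `H`, and `x u3 y` together with `P'` is an
odd hole of `G`. -/
theorem claim_interior_L1 {V : Type*}
    (ℓ : ℕ) (hℓ : 5 ≤ ℓ) (G : SimpleGraph V)
    (hG : InGFamily ℓ G) (hcrit : VertexCritical 4 G)
    (K : OddK4 G) (hlong : K.longestPair)
    (hmin : ∀ K' : OddK4 G, K'.longestPair → K.diff ≤ K'.diff)
    (e f : Sym2 V)
    (he : e = s(K.u3, K.P2.getVert 1))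
    (hf : f = s(K.u4, K.P2.getVert (K.P2.length - 1)))
    (v1 v2 : V) (P : (G.deleteEdges {e, f}).Walk v1 v2)
    (hPind : IsInducedPath (G.deleteEdges {e, f}) P)
    (hPdisj : ∀ w ∈ P.support, w ∉ K.verts)
    (hv2nbr : ∃ z ∈ interiorL K.P2, (G.deleteEdges {e, f}).Adj v2 z)
    (hv2only : ∀ w ∈ P.support,
      (∃ z ∈ interiorL K.P2, (G.deleteEdges {e, f}).Adj w z) → w = v2)
    (hv1nbr : ∃ z : V, z ∈ K.verts ∧ z ∉ interiorL K.P2 ∧ (G.deleteEdges {e, f}).Adj v1 z)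
    (hv1only : ∀ w ∈ P.support,
      (∃ z : V, z ∈ K.verts ∧ z ∉ interiorL K.P2 ∧ (G.deleteEdges {e, f}).Adj w z) → w = v1)
    (x y : V)
    (hy : y ∈ interiorL K.P2) (hv2y : G.Adj v2 y)
    (hyuniq : ∀ z ∈ interiorL K.P2, G.Adj v2 z → z = y)
    (hxH : x ∈ K.verts) (hxP2 : x ∉ interiorL K.P2) (hv1x : G.Adj v1 x)
    (hxuniq : ∀ z : V, z ∈ K.verts → z ∉ interiorL K.P2 → G.Adj v1 z → z = x)
    (P' : G.Walk x y)
    (hP' : P' = Walk.cons hv1x.symm ((P.mapLe (G.deleteEdges_le {e, f})).concat hv2y))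
    : x ∈ interiorL K.L1 →
      K.Q1.length = 1 ∧ K.P1.length = ℓ ∧ K.L1.length = ℓ ∧ P'.length = 2 * ℓ - 1 ∧
      K.toSubgraph.Adj x K.u3 ∧ K.toSubgraph.Adj K.u3 y ∧
      ∃ (h1 : G.Adj x K.u3) (h2 : G.Adj K.u3 y),
        IsOddHole G (Walk.cons h1 (Walk.cons h2 P'.reverse)) := by
  intro hx
  obtain ⟨L₁, L₃, hL⟩ := Walk.mem_support_iff_exists_append.1
    (mem_support_iff_interiorL.2 (.inr (.inr hx)))
  obtain ⟨P₃, P₄, hP₃⟩ := Walk.mem_support_iff_exists_append.1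
    (mem_support_iff_interiorL.2 (.inr (.inr hy)))
  have hyH : y ∈ K.verts := by
    rw [K.mem_verts_iff, (K.lab_iff y).2.2.2.2.2.1.2 hy]
    norm_num
  have hxy : x ≠ y := fun h ↦ hxP2 (h ▸ hy)
  have hdel {z w : V} (hz : z ∈ P.support) (h : G.Adj z w) :
      (G.deleteEdges {e, f}).Adj z w := by
    have hz' (t : V) (ht : t ∈ K.P2.support) : z ≠ t := by
      rintro rfl
      refine hPdisj z hz ((K.mem_verts_iff z).2 ?_)
      have := (K.lab_support z).2.1.1 ht
      omega
    rw [deleteEdges_adj, he, hf]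
    refine ⟨h, fun hzw ↦ ?_⟩
    have hz₃ := hz' _ K.P2.start_mem_support
    have hz₄ := hz' _ K.P2.end_mem_support
    have hz₁ := fun i ↦ hz' _ (K.P2.getVert_mem_support i)
    simp only [Set.mem_insert_iff, Set.mem_singleton_iff, Sym2.eq_iff] at hzw
    grind
  have hsupp (z : V) : z ∈ P'.support ↔ z = x ∨ z ∈ P.support ∨ z = y := by
    simp [hP', Walk.support_concat]
  have hedges (a : Sym2 V) : a ∈ P'.edges ↔ a = s(x, v1) ∨ a ∈ P.edges ∨ a = s(v2, y) := by
    simp [hP', Walk.edges_concat]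
  have hpath : P'.IsPath := by
    rw [hP', Walk.isPath_def, Walk.support_cons, Walk.support_concat, Walk.support_mapLe_eq_support]
    have := hPind.1.support_nodup
    have hxP : x ∉ P.support := fun h ↦ hPdisj x h hxH
    have hyP : y ∉ P.support := fun h ↦ hPdisj y h hyH
    simp [List.nodup_append', this, hxP, hyP, hxy]
  have hout (z w : V) (hz : z ∈ P.support) (hw : w ∈ P'.support ∨ w ∈ K.verts) (h : G.Adj z w) :
      s(z, w) ∈ P'.edges := by
    rw [hedges]
    by_cases hwP : w ∈ P.support
    · exact .inr (.inl (hPind.2 z hz w hwP (hdel hz h)))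
    have hwK : w ∈ K.verts := by grind
    by_cases hw2 : w ∈ interiorL K.P2
    · obtain rfl := hv2only z hz ⟨w, hw2, hdel hz h⟩
      exact .inr (.inr (by rw [hyuniq w hw2 h]))
    · obtain rfl := hv1only z hz ⟨w, hwK, hw2, hdel hz h⟩
      exact .inl (by rw [hxuniq w hwK hw2 h, Sym2.eq_swap])
  obtain ⟨h1, h2, h3, h4, h5, h6, h7⟩ := K.lengths_eq_of_link hG hℓ hlong hL hP₃ hx hy hpath
    (by grind) fun z hz w hw h ↦ by
      by_cases hzP : z ∈ P.support
      · exact .inl (hout z w hzP hw h)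
      by_cases hwP : w ∈ P.support
      · exact .inl (Sym2.eq_swap ▸ hout w z hwP (.inl hz) h.symm)
      · grind
  refine ⟨h1, h2, h3, h6, ?_, ?_, h7.exists_adj_of_length_eq_one h4 h5⟩
  · have := Walk.mem_edges_of_length_eq_one h4
    simp [OddK4.toSubgraph, Walk.adj_toSubgraph_iff_mem_edges, hL, this]
  · have := Walk.mem_edges_of_length_eq_one h5
    simp [OddK4.toSubgraph, Walk.adj_toSubgraph_iff_mem_edges, hP₃, this]
end

section
/- In the setup below, assume additionally that x is an internal vertex of L1, |Q1| = 1, |P1| = |L1| = ℓ, |P'| = 2ℓ−1, the edges xu3 and yu3 belong to H, and x u3 y together with P' forms an odd hole. Then no vertex in V(G) − V(H ∪ P') has two neighbours in V(H ∪ P'). -/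
open SimpleGraph

variable {V : Type*}

theorem adj_closing_walk_length {G : SimpleGraph V} {g : ℕ}
    (hgirth : ∀ (v : V) (c : G.Walk v v), c.IsCycle → g ≤ c.length)
    {a b : V} (hab : G.Adj a b) (p : G.Walk a b) (hp : s(a, b) ∉ p.edges) :
    g ≤ p.length + 1 := by
  classical
  have hc : (Walk.cons hab.symm p.bypass).IsCycle := by
    rw [Walk.cons_isCycle_iff]
    refine ⟨p.bypass_isPath, fun h => hp (p.edges_bypass_subset_edges ?_)⟩
    rwa [Sym2.eq_swap]
  have h1 := hgirth _ _ hc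
  have h2 := p.length_bypass_le_length
  rw [Walk.length_cons] at h1
  omega

theorem vertex_closing_walk_length {G : SimpleGraph V} {g : ℕ}
    (hgirth : ∀ (v : V) (c : G.Walk v v), c.IsCycle → g ≤ c.length)
    {a b w : V} (hne : a ≠ b) (ha : G.Adj w a) (hb : G.Adj w b) (p : G.Walk a b)
    (hp : w ∉ p.support) : g ≤ p.length + 2 := by
  have := adj_closing_walk_length hgirth ha (Walk.cons hb p.reverse) ?_
  · simpa using this
  rw [Walk.edges_cons, Walk.edges_reverse, List.mem_cons, List.mem_reverse, not_or]
  refine ⟨fun h => hne ?_, fun h => hp (p.fst_mem_support_of_mem_edges h)⟩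
  rcases Sym2.eq_iff.1 h with h | h
  · exact h.2
  · exact absurd h.1 hb.ne

/-- A closed walk shorter than `2g - 2`, where `g` bounds the girth from below, is chordless. -/
theorem mem_edges_of_short_closed_walk {G : SimpleGraph V} {g : ℕ}
    (hgirth : ∀ (v : V) (c : G.Walk v v), c.IsCycle → g ≤ c.length)
    {v : V} (c : G.Walk v v) (hc : c.length + 2 < 2 * g) {a b : V}
    (ha : a ∈ c.support) (hb : b ∈ c.support) (hab : G.Adj a b) : s(a, b) ∈ c.edges := by
  classical
  by_contra hcon
  have hb' : b ∈ (c.rotate a ha).support := by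
    rw [Walk.mem_support_rotate_iff]; exact hb
  have hcon' : s(a, b) ∉ (c.rotate a ha).edges := fun h =>
    hcon ((c.rotate_edges a ha).mem_iff.1 h)
  rw [← (c.rotate a ha).take_spec hb', Walk.edges_append, List.mem_append, not_or] at hcon'
  have hlen := congrArg Walk.length ((c.rotate a ha).take_spec hb')
  rw [Walk.length_append, Walk.length_rotate] at hlen
  have h1 := adj_closing_walk_length hgirth hab _ hcon'.1
  have h2 := adj_closing_walk_length hgirth hab.symm _ (Sym2.eq_swap ▸ hcon'.2)
  omega

/-- A vertex off a closed walk shorter than `2g - 4` has at most one neighbour on it. -/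
theorem eq_of_adj_short_closed_walk {G : SimpleGraph V} {g : ℕ}
    (hgirth : ∀ (v : V) (c : G.Walk v v), c.IsCycle → g ≤ c.length)
    {v w : V} (c : G.Walk v v) (hc : c.length + 4 < 2 * g) (hw : w ∉ c.support) {a b : V}
    (ha : a ∈ c.support) (hb : b ∈ c.support) (hwa : G.Adj w a) (hwb : G.Adj w b) : a = b := by
  classical
  by_contra hne
  have hb' : b ∈ (c.rotate a ha).support := by
    rw [Walk.mem_support_rotate_iff]; exact hb
  have hw' : w ∉ (c.rotate a ha).support := by
    rw [Walk.mem_support_rotate_iff]; exact hw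
  have hlen := congrArg Walk.length ((c.rotate a ha).take_spec hb')
  rw [Walk.length_append, Walk.length_rotate] at hlen
  have h1 := vertex_closing_walk_length hgirth hne hwa hwb ((c.rotate a ha).takeUntil b hb')
    (fun h => hw' (Walk.support_takeUntil_subset_support _ _ h))
  have h2 := vertex_closing_walk_length hgirth (Ne.symm hne) hwb hwa
    ((c.rotate a ha).dropUntil b hb') (fun h => hw' (Walk.support_dropUntil_subset_support _ _ h))
  omega

theorem exists_walk_of_sequence {G : SimpleGraph V} (f : ℕ → V) (n : ℕ)
    (h : ∀ t < n, G.Adj (f t) (f (t + 1))) :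
    ∃ p : G.Walk (f 0) (f n), p.length = n ∧ p.support = (List.range (n + 1)).map f := by
  induction n with
  | zero => exact ⟨Walk.nil, rfl, rfl⟩
  | succ n ih =>
    obtain ⟨p, hp, hs⟩ := ih fun t ht => h t (by omega)
    refine ⟨p.concat (h n (by omega)), by simp [hp], ?_⟩
    rw [Walk.support_concat, hs, List.range_succ (n := n + 1)]
    simp

/-- The cycle formed by an induced path and a vertex adjacent to exactly its ends is a hole. -/
theorem exists_hole_of_sequence {G : SimpleGraph V} (f : ℕ → V) (n : ℕ) (hn : 2 ≤ n)
    (hadj : ∀ t < n, G.Adj (f t) (f (t + 1)))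
    (hind : ∀ s t, s < t → t ≤ n → f s ≠ f t ∧ (G.Adj (f s) (f t) → t = s + 1))
    {w : V} (hw : ∀ t ≤ n, w ≠ f t) (hw0 : G.Adj w (f 0)) (hwn : G.Adj w (f n))
    (hwt : ∀ t ≤ n, G.Adj w (f t) → t = 0 ∨ t = n) :
    ∃ c : G.Walk w w, IsHole G c ∧ c.length = n + 2 := by
  obtain ⟨p, hlen, hs⟩ := exists_walk_of_sequence f n hadj
  have hmem : ∀ z, z ∈ p.support ↔ ∃ t ≤ n, f t = z := by
    intro z; rw [hs]; simp
  have hp : p.IsPath := by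
    rw [Walk.isPath_def, hs]
    refine List.Nodup.map_on (fun s hs t ht hst => ?_) List.nodup_range
    rw [List.mem_range] at hs ht
    rcases lt_trichotomy s t with h | h | h
    · exact absurd hst (hind s t h (by omega)).1
    · exact h
    · exact absurd hst.symm (hind t s h (by omega)).1
  have hget : ∀ t ≤ n, p.getVert t = f t := by
    intro t ht
    rw [Walk.getVert_eq_support_getElem p (by omega)]
    simp [hs]
  have hedge : ∀ t < n, s(f t, f (t + 1)) ∈ p.edges := by
    intro t ht
    rw [← hget t (by omega), ← hget (t + 1) (by omega), ← Walk.mem_edges_toSubgraph,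
      Subgraph.mem_edgeSet]
    exact Walk.toSubgraph_adj_getVert p (by omega)
  have hwp : w ∉ p.support := fun h => by
    obtain ⟨t, ht, h⟩ := (hmem w).1 h
    exact hw t ht h.symm
  have hne : f 0 ≠ f n := (hind 0 n (by omega) le_rfl).1
  refine ⟨Walk.cons hw0 (p.concat hwn.symm), ⟨?_, ?_, ?_⟩, by simp [hlen]⟩
  · rw [Walk.cons_isCycle_iff]
    refine ⟨(Walk.concat_isPath_iff _).2 ⟨hp, hwp⟩, ?_⟩
    rw [Walk.edges_concat, List.concat_eq_append, List.mem_append, not_or]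
    refine ⟨fun h => hwp (p.fst_mem_support_of_mem_edges h), fun h => hne ?_⟩
    have := hw0.ne
    have := hwn.ne
    simp at h
    grind
  · simp [hlen]; omega
  · have hsup : ∀ z ∈ (Walk.cons hw0 (p.concat hwn.symm)).support, z = w ∨ ∃ t ≤ n, f t = z := by
      intro z hz
      rw [← hmem]
      simp [Walk.support_concat] at hz
      tauto
    have hedges : ∀ e, e ∈ (Walk.cons hw0 (p.concat hwn.symm)).edges ↔
        e = s(w, f 0) ∨ e ∈ p.edges ∨ e = s(f n, w) := by
      intro e; simp [Walk.edges_concat]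
    have hwz : ∀ t ≤ n, G.Adj w (f t) → s(w, f t) = s(w, f 0) ∨ s(w, f t) = s(f n, w) := by
      intro t ht h
      rcases hwt t ht h with rfl | rfl
      · exact Or.inl rfl
      · exact Or.inr Sym2.eq_swap
    intro x hx y hy hxy
    rw [hedges]
    rcases hsup x hx with rfl | ⟨s, hs, rfl⟩ <;> rcases hsup y hy with rfl | ⟨t, ht, rfl⟩
    · exact absurd hxy (G.loopless.irrefl _)
    · rcases hwz t ht hxy with h | h <;> tauto
    · rw [Sym2.eq_swap]
      rcases hwz s hs hxy.symm with h | h <;> tauto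
    · rcases lt_trichotomy s t with h | h | h
      · obtain rfl := (hind s t h ht).2 hxy
        exact Or.inr (Or.inl (hedge s (by omega)))
      · exact absurd (h ▸ hxy) (G.loopless.irrefl _)
      · obtain rfl := (hind t s h hs).2 hxy.symm
        rw [Sym2.eq_swap]
        exact Or.inr (Or.inl (hedge t (by omega)))

/-- Adjacency in the graph `H ∪ P'`, with its vertices numbered as follows: `P'` runs through
`0, …, 2ℓ-1` (from `x` to `y`), `u₃ = 2ℓ`, the arris from `u₂` to `u₁` through
`2ℓ+1, …, 3ℓ+1`, the one from `u₁` to `x` through `3ℓ+1, …, 4ℓ-1, 0`, the one from `u₂` to `u₄`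
through `2ℓ+1, 4ℓ, …, 5ℓ-1`, and the one from `u₄` to `y` through `5ℓ-1, …, 6ℓ-3, 2ℓ-1`. -/
def modelAdj (ℓ i j : ℕ) : Prop :=
  (j = i + 1 ∧ j ≠ 4 * ℓ) ∨ (i = j + 1 ∧ i ≠ 4 * ℓ) ∨
  (i = 0 ∧ j = 2 * ℓ) ∨ (j = 0 ∧ i = 2 * ℓ) ∨
  (i = 0 ∧ j + 1 = 4 * ℓ) ∨ (j = 0 ∧ i + 1 = 4 * ℓ) ∨
  (i = 2 * ℓ + 1 ∧ j = 4 * ℓ) ∨ (j = 2 * ℓ + 1 ∧ i = 4 * ℓ) ∨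
  (i = 3 * ℓ + 1 ∧ j + 1 = 5 * ℓ) ∨ (j = 3 * ℓ + 1 ∧ i + 1 = 5 * ℓ) ∨
  (i + 1 = 2 * ℓ ∧ j + 3 = 6 * ℓ) ∨ (j + 1 = 2 * ℓ ∧ i + 3 = 6 * ℓ)

/-- `f 0, …, f n` is an induced path from `i` to `j` in the numbered graph. -/
structure IsModelPath (ℓ i j n : ℕ) (f : ℕ → ℕ) : Prop where
  two_le : 2 ≤ n
  start : f 0 = i
  finish : f n = j
  lt : ∀ t ≤ n, f t < 6 * ℓ - 2
  step : ∀ t < n, modelAdj ℓ (f t) (f (t + 1))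
  induced : ∀ s t, s < t → t ≤ n → f s ≠ f t ∧ (modelAdj ℓ (f s) (f t) → t = s + 1)

theorem length_of_model_path {G : SimpleGraph V} {ℓ : ℕ}
    (hodd : ∀ (v : V) (c : G.Walk v v), IsOddHole G c → c.length = 2 * ℓ + 1)
    {g : ℕ → V} (hinj : ∀ i j, i < 6 * ℓ - 2 → j < 6 * ℓ - 2 → g i = g j → i = j)
    (hadj : ∀ i j, i < 6 * ℓ - 2 → j < 6 * ℓ - 2 → (G.Adj (g i) (g j) ↔ modelAdj ℓ i j))
    {w : V} (hw : ∀ i, i < 6 * ℓ - 2 → w ≠ g i) {i j : ℕ}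
    (hwi : G.Adj w (g i)) (hwj : G.Adj w (g j))
    (honly : ∀ k, k < 6 * ℓ - 2 → G.Adj w (g k) → k = i ∨ k = j)
    {f : ℕ → ℕ} {n : ℕ} (hf : IsModelPath ℓ i j n f)
    (hnodd : Odd n) : n + 1 = 2 * ℓ := by
  obtain ⟨hn, hf0, hfn, hlt, hstep, hind⟩ := hf
  have hfinj : ∀ s t, s ≤ n → t ≤ n → f s = f t → s = t := by
    intro s t hs ht h
    rcases lt_trichotomy s t with h' | h' | h'
    · exact absurd h (hind s t h' ht).1
    · exact h'
    · exact absurd h.symm (hind t s h' hs).1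
  obtain ⟨c, hc, hlen⟩ := exists_hole_of_sequence (fun t => g (f t)) n hn
    (fun t ht => (hadj _ _ (hlt t ht.le) (hlt _ ht)).2 (hstep t ht))
    (fun s t hst ht => ⟨fun h => (hind s t hst ht).1 (hinj _ _ (hlt s (by omega)) (hlt t ht) h),
      fun h => (hind s t hst ht).2 ((hadj _ _ (hlt s (by omega)) (hlt t ht)).1 h)⟩)
    (fun t ht => hw _ (hlt t ht)) (hf0 ▸ hwi) (hfn ▸ hwj)
    (fun t ht h => (honly _ (hlt t ht) h).imp
      (fun h => hfinj t 0 ht (by omega) (h.trans hf0.symm))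
      (fun h => hfinj t n ht le_rfl (h.trans hfn.symm)))
  have := hodd w c ⟨hc, by rw [hlen]; exact hnodd.add_even even_two⟩
  omega

theorem modelPath_down {ℓ i s : ℕ} (hℓ : 5 ≤ ℓ) (hi : 2 * ℓ + 1 ≤ i) (hi' : i < 4 * ℓ)
    (hs : 1 ≤ s) (hs' : s ≤ 2 * ℓ - 2) :
    IsModelPath ℓ i s (i - s) (fun t => i - t) := by
  refine ⟨by omega, ?_, ?_, ?_, ?_, ?_⟩
  · omega
  · omega
  · intro t ht
    omega
  · intro t ht
    unfold modelAdj
    repeat first | (left; constructor <;> omega) | right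
  · intro r t hr ht
    unfold modelAdj
    omega

theorem modelPath_up {ℓ i s : ℕ} (hℓ : 5 ≤ ℓ) (hi : 2 * ℓ + 1 ≤ i) (hi' : i ≤ 3 * ℓ)
    (hs : 1 ≤ s) (hs' : s ≤ 2 * ℓ - 2) :
    IsModelPath ℓ i s (4 * ℓ - i + s)
      (fun t => if t < 4 * ℓ - i then i + t else t - (4 * ℓ - i)) := by
  refine ⟨by omega, ?_, ?_, ?_, ?_, ?_⟩
  · split_ifs <;> omega
  · split_ifs <;> omega
  · intro t ht
    split_ifs <;> omega
  · intro t ht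
    split_ifs <;> unfold modelAdj <;>
      repeat first | (left; constructor <;> omega) | right
  · intro r t hr ht
    unfold modelAdj
    split_ifs <;> omega

theorem modelPath_far {ℓ k s : ℕ} (hℓ : 5 ≤ ℓ) (hk : k < ℓ)
    (hs : 1 ≤ s) (hs' : s ≤ 2 * ℓ - 2) :
    IsModelPath ℓ (2 * ℓ + 1 + k) s (4 * ℓ - 2 + k - s)
      (fun t => if t ≤ k then 2 * ℓ + 1 + k - t else if t ≤ k + 2 * ℓ - 2 then 4 * ℓ + (t - k - 1)
        else 4 * ℓ - 2 + k - t) := by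
  refine ⟨by omega, ?_, ?_, ?_, ?_, ?_⟩
  · split_ifs <;> omega
  · split_ifs <;> omega
  · intro t ht
    split_ifs <;> omega
  · intro t ht
    split_ifs <;> unfold modelAdj <;>
      repeat first | (left; constructor <;> omega) | right
    all_goals constructor <;> omega
  · intro r t hr ht
    unfold modelAdj
    split_ifs <;> omega

theorem modelPath_over {ℓ k s : ℕ} (hℓ : 5 ≤ ℓ) (hk : 1 ≤ k) (hk' : k < ℓ)
    (hs : 1 ≤ s) (hs' : s ≤ 2 * ℓ - 2) :
    IsModelPath ℓ (4 * ℓ - k) s (4 * ℓ - 2 - k - s)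
      (fun t => if t < ℓ - k then 4 * ℓ - k - t else if t ≤ 2 * ℓ - k - 2 then 4 * ℓ + k - 1 + t
        else 4 * ℓ - 2 - k - t) := by
  refine ⟨by omega, ?_, ?_, ?_, ?_, ?_⟩
  · split_ifs <;> omega
  · split_ifs <;> omega
  · intro t ht
    split_ifs <;> omega
  · intro t ht
    split_ifs <;> unfold modelAdj <;>
      repeat first | (left; constructor <;> omega) | right
    all_goals constructor <;> omega
  · intro r t hr ht
    unfold modelAdj
    split_ifs <;> omega

theorem modelPath_near {ℓ k s : ℕ} (hℓ : 5 ≤ ℓ) (hk : 1 ≤ k) (hk' : k < ℓ)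
    (hs : 2 ≤ s) (hs' : s ≤ 2 * ℓ - 2) :
    IsModelPath ℓ (4 * ℓ - k) s (2 * ℓ + 1 + k - s)
      (fun t => if t < k then 4 * ℓ - k + t else if t ≤ k then 0 else 2 * ℓ + 1 + k - t) := by
  refine ⟨by omega, ?_, ?_, ?_, ?_, ?_⟩
  · split_ifs <;> omega
  · split_ifs <;> omega
  · intro t ht
    split_ifs <;> omega
  · intro t ht
    split_ifs <;> unfold modelAdj <;>
      repeat first | (left; constructor <;> omega) | right
  · intro r t hr ht
    unfold modelAdj
    split_ifs <;> first | omega | (simp only [false_and, false_or]; omega)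

theorem modelPath_around {ℓ k s : ℕ} (hℓ : 5 ≤ ℓ) (hk : 2 ≤ k) (hk' : k < ℓ)
    (hs : 1 ≤ s) (hs' : s ≤ 2 * ℓ - 2) :
    IsModelPath ℓ (4 * ℓ - k) s (2 * ℓ - k + 1 + s)
      (fun t => if t ≤ 2 * ℓ - k then 4 * ℓ - k - t else t - (2 * ℓ - k + 1)) := by
  refine ⟨by omega, ?_, ?_, ?_, ?_, ?_⟩
  · split_ifs <;> omega
  · split_ifs <;> omega
  · intro t ht
    split_ifs <;> omega
  · intro t ht
    split_ifs <;> unfold modelAdj <;>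
      repeat first | (left; constructor <;> omega) | right
  · intro r t hr ht
    unfold modelAdj
    split_ifs <;> omega

theorem no_model_neighbours_left {G : SimpleGraph V} {ℓ : ℕ} (hℓ : 5 ≤ ℓ)
    (hgirth : ∀ (v : V) (c : G.Walk v v), c.IsCycle → 2 * ℓ + 1 ≤ c.length)
    (hodd : ∀ (v : V) (c : G.Walk v v), IsOddHole G c → c.length = 2 * ℓ + 1)
    {g : ℕ → V} (hinj : ∀ i j, i < 6 * ℓ - 2 → j < 6 * ℓ - 2 → g i = g j → i = j)
    (hadj : ∀ i j, i < 6 * ℓ - 2 → j < 6 * ℓ - 2 → (G.Adj (g i) (g j) ↔ modelAdj ℓ i j))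
    {w : V} (hw : ∀ i, i < 6 * ℓ - 2 → w ≠ g i) {i s : ℕ}
    (hwi : G.Adj w (g i)) (hws : G.Adj w (g s))
    (honly : ∀ k, k < 6 * ℓ - 2 → G.Adj w (g k) → k = i ∨ k = s)
    (hi : 2 * ℓ + 1 ≤ i) (hi' : i < 4 * ℓ) (hs : 1 ≤ s) (hs' : s ≤ 2 * ℓ - 2) : False := by
  rcases le_or_gt i (3 * ℓ) with hi3 | hi3
  · obtain ⟨k, rfl⟩ := Nat.exists_eq_add_of_le hi
    have hdown := length_of_model_path hodd hinj hadj hw hwi hws honly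
      (modelPath_down hℓ hi hi' hs hs')
    have hup := length_of_model_path hodd hinj hadj hw hwi hws honly
      (modelPath_up hℓ hi hi3 hs hs')
    have hfar := length_of_model_path hodd hinj hadj hw hwi hws honly
      (modelPath_far hℓ (by omega) hs hs')
    rw [Nat.odd_iff] at hdown hup hfar
    omega
  · obtain ⟨k, hk⟩ := Nat.exists_eq_add_of_le hi'.le
    obtain rfl : i = 4 * ℓ - k := by omega
    have hk1 : 1 ≤ k := by omega
    have hkl : k < ℓ := by omega
    have hdown := length_of_model_path hodd hinj hadj hw hwi hws honly
      (modelPath_down hℓ hi hi' hs hs')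
    have hover := length_of_model_path hodd hinj hadj hw hwi hws honly
      (modelPath_over hℓ hk1 hkl hs hs')
    have hnear := fun h => length_of_model_path hodd hinj hadj hw hwi hws honly
      (modelPath_near hℓ hk1 hkl h hs')
    have haround := fun h => length_of_model_path hodd hinj hadj hw hwi hws honly
      (modelPath_around hℓ h hkl hs hs')
    rw [Nat.odd_iff] at hdown hover
    simp only [Nat.odd_iff] at hnear haround
    have hshort : k + s ≤ 4 := by omega
    obtain ⟨p, hp, hsup⟩ := exists_walk_of_sequence (G := G)
      (fun t => g (if t < k then 4 * ℓ - k + t else t - k)) (k + s) (by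
        intro t ht
        refine (hadj _ _ (by split_ifs <;> omega) (by split_ifs <;> omega)).2 ?_
        split_ifs <;> unfold modelAdj <;>
          repeat first | (left; constructor <;> omega) | right)
    have h0 : g (if 0 < k then 4 * ℓ - k + 0 else 0 - k) = g (4 * ℓ - k) := by
      rw [if_pos (by omega), add_zero]
    have h1 : g (if k + s < k then 4 * ℓ - k + (k + s) else k + s - k) = g s := by
      rw [if_neg (by omega), Nat.add_sub_cancel_left]
    have := vertex_closing_walk_length hgirth
      (fun h => by
        rw [h0, h1] at h
        have := hinj _ _ (by omega) (by omega) h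
        omega)
      (h0.symm ▸ hwi) (h1.symm ▸ hws) p (fun h => by
        rw [hsup, List.mem_map] at h
        obtain ⟨t, ht, h⟩ := h
        rw [List.mem_range] at ht
        exact hw _ (by split_ifs <;> omega) h.symm)
    omega

/-- The involution of the numbered graph exchanging `x` with `y` and `u₁` with `u₄`. -/
def modelSwap (ℓ i : ℕ) : ℕ :=
  if i < 2 * ℓ then 2 * ℓ - 1 - i else if i ≤ 2 * ℓ + 1 then i
  else if i < 4 * ℓ then i + (2 * ℓ - 2) else i - (2 * ℓ - 2)

theorem modelSwap_lt {ℓ i : ℕ} (hℓ : 5 ≤ ℓ) (hi : i < 6 * ℓ - 2) :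
    modelSwap ℓ i < 6 * ℓ - 2 := by
  unfold modelSwap
  split_ifs <;> omega

theorem modelSwap_modelSwap {ℓ i : ℕ} (hi : i < 6 * ℓ - 2) :
    modelSwap ℓ (modelSwap ℓ i) = i := by
  unfold modelSwap
  split_ifs <;> omega

theorem modelAdj.swap {ℓ i j : ℕ} (hℓ : 5 ≤ ℓ) (hi : i < 6 * ℓ - 2) (hj : j < 6 * ℓ - 2)
    (h : modelAdj ℓ i j) : modelAdj ℓ (modelSwap ℓ i) (modelSwap ℓ j) := by
  unfold modelAdj at h
  unfold modelSwap
  rcases h with h | h | h | h | h | h | h | h | h | h | h | h <;> split_ifs <;>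
    first | omega | (unfold modelAdj; repeat first | (left; constructor <;> omega) | right)
  all_goals constructor <;> omega

theorem modelAdj_modelSwap {ℓ i j : ℕ} (hℓ : 5 ≤ ℓ) (hi : i < 6 * ℓ - 2) (hj : j < 6 * ℓ - 2) :
    modelAdj ℓ (modelSwap ℓ i) (modelSwap ℓ j) ↔ modelAdj ℓ i j := by
  refine ⟨fun h => ?_, fun h => h.swap hℓ hi hj⟩
  have := h.swap hℓ (modelSwap_lt hℓ hi) (modelSwap_lt hℓ hj)
  rwa [modelSwap_modelSwap hi, modelSwap_modelSwap hj] at this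

theorem no_model_neighbours {G : SimpleGraph V} {ℓ : ℕ} (hℓ : 5 ≤ ℓ)
    (hgirth : ∀ (v : V) (c : G.Walk v v), c.IsCycle → 2 * ℓ + 1 ≤ c.length)
    (hodd : ∀ (v : V) (c : G.Walk v v), IsOddHole G c → c.length = 2 * ℓ + 1)
    {g : ℕ → V} (hinj : ∀ i j, i < 6 * ℓ - 2 → j < 6 * ℓ - 2 → g i = g j → i = j)
    (hadj : ∀ i j, i < 6 * ℓ - 2 → j < 6 * ℓ - 2 → (G.Adj (g i) (g j) ↔ modelAdj ℓ i j))
    {w : V} (hw : ∀ i, i < 6 * ℓ - 2 → w ≠ g i) {i s : ℕ}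
    (hwi : G.Adj w (g i)) (hws : G.Adj w (g s))
    (honly : ∀ k, k < 6 * ℓ - 2 → G.Adj w (g k) → k = i ∨ k = s)
    (hi : 2 * ℓ + 1 ≤ i) (hi' : i < 6 * ℓ - 2) (hs : 1 ≤ s) (hs' : s ≤ 2 * ℓ - 2) : False := by
  rcases lt_or_ge i (4 * ℓ) with hi4 | hi4
  · exact no_model_neighbours_left hℓ hgirth hodd hinj hadj hw hwi hws honly hi hi4 hs hs'
  · have hsl : s < 6 * ℓ - 2 := by omega
    refine no_model_neighbours_left (g := fun t => g (modelSwap ℓ t)) (w := w)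
      (i := modelSwap ℓ i) (s := modelSwap ℓ s) hℓ hgirth hodd ?_ ?_ ?_ ?_ ?_ ?_ ?_ ?_ ?_ ?_
    · intro a b ha hb h
      have := hinj _ _ (modelSwap_lt hℓ ha) (modelSwap_lt hℓ hb) h
      rw [← modelSwap_modelSwap ha, this, modelSwap_modelSwap hb]
    · intro a b ha hb
      rw [hadj _ _ (modelSwap_lt hℓ ha) (modelSwap_lt hℓ hb), modelAdj_modelSwap hℓ ha hb]
    · exact fun a ha => hw _ (modelSwap_lt hℓ ha)
    · simpa only [modelSwap_modelSwap hi'] using hwi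
    · simpa only [modelSwap_modelSwap hsl] using hws
    · intro a ha h
      refine (honly _ (modelSwap_lt hℓ ha) h).imp (fun h => ?_) (fun h => ?_) <;>
        rw [← h, modelSwap_modelSwap ha]
    all_goals unfold modelSwap; split_ifs <;> omega

theorem mem_interiorL_iff {G : SimpleGraph V} {a b : V} (p : G.Walk a b) {v : V} :
    v ∈ interiorL p ↔ ∃ k, 0 < k ∧ k < p.length ∧ p.getVert k = v := by
  have hlen : (interiorL p).length = p.length - 1 := by simp [interiorL]
  constructor
  · intro h
    obtain ⟨k, hk, rfl⟩ := List.mem_iff_getElem.1 h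
    refine ⟨k + 1, by omega, by omega, ?_⟩
    rw [Walk.getVert_eq_support_getElem p (by omega)]
    simp [interiorL]
  · rintro ⟨k, hk, hk', rfl⟩
    refine List.mem_iff_getElem.2 ⟨k - 1, by omega, ?_⟩
    rw [Walk.getVert_eq_support_getElem p (by omega)]
    simp [interiorL, Nat.sub_add_cancel hk]

/-- A path of length at most the girth minus two has no chord at its last vertex. -/
theorem getVert_of_adj_last {G : SimpleGraph V} {g : ℕ}
    (hgirth : ∀ (v : V) (c : G.Walk v v), c.IsCycle → g ≤ c.length)
    {a b v : V} {p : G.Walk a b} (hp : p.IsPath) (hlen : p.length + 1 < g)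
    (hv : v ∈ p.support) (hvb : G.Adj v b) : p.getVert (p.length - 1) = v := by
  obtain ⟨k, rfl, hk⟩ := Walk.mem_support_iff_exists_getVert.1 hv
  by_contra hne
  have hk' : k ≠ p.length := fun h => by
    rw [h, p.getVert_length] at hvb
    exact hvb.ne rfl
  obtain ⟨n, hn⟩ := Nat.exists_eq_add_of_le (show k ≤ p.length - 1 by omega)
  obtain ⟨q, hq, hsup⟩ := exists_walk_of_sequence (G := G) (fun t => p.getVert (k + t)) n
    fun t ht => p.adj_getVert_succ (by omega)
  have hlast : G.Adj b (p.getVert (k + n)) := by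
    have := p.adj_getVert_succ (i := k + n) (by omega)
    rw [show k + n + 1 = p.length by omega, p.getVert_length] at this
    exact this.symm
  have := vertex_closing_walk_length hgirth (w := b) (by rw [hn] at hne; exact Ne.symm hne)
    hvb.symm hlast q (fun h => by
      rw [hsup, List.mem_map] at h
      obtain ⟨t, ht, h⟩ := h
      rw [List.mem_range] at ht
      have := hp.getVert_injOn (x₁ := k + t) (x₂ := p.length) (by simp; omega) (by simp)
        (h.trans p.getVert_length.symm)
      omega)
  omega

theorem OddK4.mem_verts_iff_s14 {G : SimpleGraph V} (K : OddK4 G) {v : V} :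
    v ∈ K.verts ↔ v ∈ K.P1.support ∨ v ∈ K.P2.support ∨ v ∈ K.Q1.support ∨
      v ∈ K.Q2.support ∨ v ∈ K.L1.support ∨ v ∈ K.L2.support := by
  simp only [OddK4.verts, OddK4.toSubgraph, Subgraph.verts_sup, Set.mem_union,
    Walk.mem_verts_toSubgraph]
  tauto

theorem OddK4.mem_edgeSet_iff {G : SimpleGraph V} (K : OddK4 G) {e : Sym2 V} :
    e ∈ K.toSubgraph.edgeSet ↔ e ∈ K.P1.edges ∨ e ∈ K.P2.edges ∨ e ∈ K.Q1.edges ∨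
      e ∈ K.Q2.edges ∨ e ∈ K.L1.edges ∨ e ∈ K.L2.edges := by
  simp only [OddK4.toSubgraph, Subgraph.edgeSet_sup, Set.mem_union, Walk.mem_edges_toSubgraph]
  tauto

theorem OddK4.exists_short_closed_walk {G : SimpleGraph V} (K : OddK4 G) {n : ℕ}
    (h1 : K.P1.length + K.Q1.length + K.L1.length ≤ n)
    (h2 : K.P1.length + K.Q2.length + K.L2.length ≤ n)
    (h3 : K.P2.length + K.Q2.length + K.L1.length ≤ n)
    (h4 : K.P2.length + K.Q1.length + K.L2.length ≤ n)
    (h5 : K.P1.length + K.P2.length + K.Q1.length + K.Q2.length ≤ n)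
    (h6 : K.L1.length + K.L2.length + K.Q1.length + K.Q2.length ≤ n)
    {a b : V} (ha : a ∈ K.verts) (hb : b ∈ K.verts) :
    ∃ (v : V) (c : G.Walk v v), c.length ≤ n ∧ a ∈ c.support ∧ b ∈ c.support ∧
      (∀ z ∈ c.support, z ∈ K.verts) ∧ ∀ e ∈ c.edges, e ∈ K.toSubgraph.edgeSet := by
  have key : ∀ (v : V) (c : G.Walk v v), c.length ≤ n → (∀ z ∈ c.support, z ∈ K.verts) →
      (∀ e ∈ c.edges, e ∈ K.toSubgraph.edgeSet) → a ∈ c.support → b ∈ c.support →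
      ∃ (v : V) (c : G.Walk v v), c.length ≤ n ∧ a ∈ c.support ∧ b ∈ c.support ∧
        (∀ z ∈ c.support, z ∈ K.verts) ∧ ∀ e ∈ c.edges, e ∈ K.toSubgraph.edgeSet :=
    fun v c hn hz he ha hb => ⟨v, c, hn, ha, hb, hz, he⟩
  have k1 := key _ (K.P1.append (K.Q1.append K.L1.reverse))
  have k2 := key _ (K.P1.append (K.L2.append K.Q2.reverse))
  have k3 := key _ (K.L1.append (K.P2.append K.Q2.reverse))
  have k4 := key _ (K.Q1.append (K.P2.append K.L2.reverse))
  have k5 := key _ (K.P1.append (K.Q1.append (K.P2.append K.Q2.reverse)))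
  have k6 := key _ (K.L1.append (K.Q1.reverse.append (K.L2.append K.Q2.reverse)))
  clear key
  simp only [Walk.mem_support_append_iff, Walk.edges_append, Walk.length_append,
    Walk.length_reverse, Walk.support_reverse, Walk.edges_reverse, List.mem_append,
    List.mem_reverse, K.mem_verts_iff_s14, K.mem_edgeSet_iff] at k1 k2 k3 k4 k5 k6 ha hb ⊢
  replace k1 := k1 (by omega) (fun z hz => by rcases hz with h | h | h <;> simp [h])
    (fun z hz => by rcases hz with h | h | h <;> simp [h])
  replace k2 := k2 (by omega) (fun z hz => by rcases hz with h | h | h <;> simp [h])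
    (fun z hz => by rcases hz with h | h | h <;> simp [h])
  replace k3 := k3 (by omega) (fun z hz => by rcases hz with h | h | h <;> simp [h])
    (fun z hz => by rcases hz with h | h | h <;> simp [h])
  replace k4 := k4 (by omega) (fun z hz => by rcases hz with h | h | h <;> simp [h])
    (fun z hz => by rcases hz with h | h | h <;> simp [h])
  replace k5 := k5 (by omega) (fun z hz => by rcases hz with h | h | h | h <;> simp [h])
    (fun z hz => by rcases hz with h | h | h | h <;> simp [h])
  replace k6 := k6 (by omega) (fun z hz => by rcases hz with h | h | h | h <;> simp [h])
    (fun z hz => by rcases hz with h | h | h | h <;> simp [h])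
  generalize (∃ _, _ : Prop) = C at k1 k2 k3 k4 k5 k6 ⊢
  rcases ha with ha | ha | ha | ha | ha | ha <;> rcases hb with hb | hb | hb | hb | hb | hb <;>
    first
      | exact k1 (by simp only [ha, true_or, or_true]) (by simp only [hb, true_or, or_true])
      | exact k2 (by simp only [ha, true_or, or_true]) (by simp only [hb, true_or, or_true])
      | exact k3 (by simp only [ha, true_or, or_true]) (by simp only [hb, true_or, or_true])
      | exact k4 (by simp only [ha, true_or, or_true]) (by simp only [hb, true_or, or_true])
      | exact k5 (by simp only [ha, true_or, or_true]) (by simp only [hb, true_or, or_true])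
      | exact k6 (by simp only [ha, true_or, or_true]) (by simp only [hb, true_or, or_true])

/-- A path `p` of length `2ℓ - 1` attached to a `K₄`-subdivision whose arrises `Q1`, `Q2` are
edges and whose other arrises have length `ℓ`; its ends are the neighbours of `u3` on `L1`
and `P2`. -/
structure OddK4.IsHandle {G : SimpleGraph V} (K : OddK4 G) (ℓ : ℕ) {x y : V}
    (p : G.Walk x y) : Prop where
  length_P1 : K.P1.length = ℓ
  length_P2 : K.P2.length = ℓ
  length_Q1 : K.Q1.length = 1
  length_Q2 : K.Q2.length = 1
  length_L1 : K.L1.length = ℓ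
  length_L2 : K.L2.length = ℓ
  left_eq : K.L1.getVert (ℓ - 1) = x
  right_eq : K.P2.getVert 1 = y
  length_eq : p.length = 2 * ℓ - 1
  isPath : p.IsPath
  not_mem : ∀ k, 0 < k → k < p.length → p.getVert k ∉ K.verts

/-- The numbering of the vertices of a `K₄`-subdivision with a handle used by `modelAdj`. -/
def OddK4.number {G : SimpleGraph V} (K : OddK4 G) (ℓ : ℕ) {x y : V} (p : G.Walk x y)
    (i : ℕ) : V :=
  if i < 2 * ℓ then p.getVert i else if i = 2 * ℓ then K.u3
  else if i ≤ 3 * ℓ + 1 then K.P1.getVert (3 * ℓ + 1 - i)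
  else if i < 4 * ℓ then K.L1.getVert (i - (3 * ℓ + 1))
  else if i < 5 * ℓ then K.L2.getVert (i + 1 - 4 * ℓ)
  else K.P2.getVert (6 * ℓ - 1 - i)

/-- The vertices of the walk `q` have the numbers `φ 0, φ 1, …` under `g`, and these form a walk
in the numbered graph. -/
def IsNumberedBy {G : SimpleGraph V} (ℓ : ℕ) (g : ℕ → V) {a b : V} (q : G.Walk a b)
    (φ : ℕ → ℕ) : Prop :=
  ∀ k ≤ q.length, q.getVert k = g (φ k) ∧ φ k < 6 * ℓ - 2 ∧
    (k < q.length → modelAdj ℓ (φ k) (φ (k + 1)))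

theorem modelAdj.symm {ℓ i j : ℕ} (h : modelAdj ℓ i j) : modelAdj ℓ j i := by
  unfold modelAdj at h ⊢
  grind

theorem IsNumberedBy.exists_modelAdj {G : SimpleGraph V} {ℓ : ℕ} {g : ℕ → V} {a b : V}
    {q : G.Walk a b} {φ : ℕ → ℕ} (hq : IsNumberedBy ℓ g q φ) {u v : V} (h : s(u, v) ∈ q.edges) :
    ∃ i j, i < 6 * ℓ - 2 ∧ j < 6 * ℓ - 2 ∧ modelAdj ℓ i j ∧ u = g i ∧ v = g j := by
  rw [← Walk.mem_edges_toSubgraph, Subgraph.mem_edgeSet, Walk.toSubgraph_adj_iff] at h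
  obtain ⟨k, h, hk⟩ := h
  obtain ⟨h0, hlt0, hadj⟩ := hq k hk.le
  obtain ⟨h1, hlt1, -⟩ := hq (k + 1) hk
  rw [h0, h1, Sym2.eq_iff] at h
  rcases h with ⟨hu, hv⟩ | ⟨hv, hu⟩
  · exact ⟨_, _, hlt0, hlt1, hadj hk, hu.symm, hv.symm⟩
  · exact ⟨_, _, hlt1, hlt0, (hadj hk).symm, hu.symm, hv.symm⟩

theorem IsNumberedBy.adj {G : SimpleGraph V} {ℓ : ℕ} {g : ℕ → V} {a b : V}
    {q : G.Walk a b} {φ : ℕ → ℕ} (hq : IsNumberedBy ℓ g q φ) {i j : ℕ} (k : ℕ)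
    (hk : k < q.length) (hi : φ k = i) (hj : φ (k + 1) = j) : G.Adj (g i) (g j) := by
  have := q.adj_getVert_succ hk
  rwa [(hq k hk.le).1, (hq (k + 1) hk).1, hi, hj] at this

namespace OddK4.IsHandle

variable {G : SimpleGraph V} {K : OddK4 G} {ℓ : ℕ} {x y : V} {p : G.Walk x y}

theorem number_self (h : K.IsHandle ℓ p) (hℓ : 5 ≤ ℓ) :
    IsNumberedBy ℓ (K.number ℓ p) p id := by
  intro k hk
  have := h.length_eq
  refine ⟨?_, by dsimp only [id]; omega, fun _ => Or.inl ⟨rfl, by dsimp only [id]; omega⟩⟩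
  rw [number, id, if_pos (by omega)]

theorem number_P1 (h : K.IsHandle ℓ p) (hℓ : 5 ≤ ℓ) :
    IsNumberedBy ℓ (K.number ℓ p) K.P1 (fun k => 3 * ℓ + 1 - k) := by
  intro k hk
  have := h.length_P1
  unfold number
  dsimp only
  refine ⟨?_, by omega, fun _ => Or.inr (Or.inl ⟨by omega, by omega⟩)⟩
  split_ifs <;> first | omega | (congr 1; omega)

theorem number_L1 (h : K.IsHandle ℓ p) (hℓ : 5 ≤ ℓ) :
    IsNumberedBy ℓ (K.number ℓ p) K.L1
      (fun k => if k + 1 < ℓ then 3 * ℓ + 1 + k else if k < ℓ then 0 else 2 * ℓ) := by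
  intro k hk
  have := h.length_L1
  have hp := K.P1.getVert_zero
  have hl := K.L1.getVert_zero
  refine ⟨?_, by dsimp only; split_ifs <;> omega, fun _ => ?_⟩
  · dsimp only
    split_ifs with h1 h2
    · rcases Nat.eq_zero_or_pos k with rfl | h0
      · rw [hl, number, if_neg (by omega), if_neg (by omega), if_pos (by omega),
          show 3 * ℓ + 1 - (3 * ℓ + 1 + 0) = 0 by omega, hp]
      · rw [number, if_neg (by omega), if_neg (by omega), if_neg (by omega), if_pos (by omega)]
        congr 1
        omega
    · rw [number, if_pos (by omega), p.getVert_zero, ← h.left_eq]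
      congr 1
      omega
    · rw [number, if_neg (by omega), if_pos rfl, show k = K.L1.length by omega,
        K.L1.getVert_length]
  · dsimp only
    split_ifs <;>
      first | (exfalso; omega) | (unfold modelAdj; repeat first | (constructor <;> omega) | right)

theorem number_L2 (h : K.IsHandle ℓ p) (hℓ : 5 ≤ ℓ) :
    IsNumberedBy ℓ (K.number ℓ p) K.L2
      (fun k => if k = 0 then 2 * ℓ + 1 else 4 * ℓ - 1 + k) := by
  intro k hk
  have := h.length_L2
  refine ⟨?_, by dsimp only; split_ifs <;> omega, fun _ => ?_⟩
  · dsimp only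
    split_ifs with h1
    · rw [h1, K.L2.getVert_zero, number, if_neg (by omega), if_neg (by omega), if_pos (by omega),
        show 3 * ℓ + 1 - (2 * ℓ + 1) = K.P1.length by rw [h.length_P1]; omega,
        K.P1.getVert_length]
    · rw [number, if_neg (by omega), if_neg (by omega), if_neg (by omega), if_neg (by omega),
        if_pos (by omega)]
      congr 1
      omega
  · dsimp only
    split_ifs <;>
      first | (exfalso; omega) | (unfold modelAdj; repeat first | (constructor <;> omega) | right)

theorem number_P2 (h : K.IsHandle ℓ p) (hℓ : 5 ≤ ℓ) :
    IsNumberedBy ℓ (K.number ℓ p) K.P2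
      (fun k => if k = 0 then 2 * ℓ else if k = 1 then 2 * ℓ - 1 else 6 * ℓ - 1 - k) := by
  intro k hk
  have := h.length_P2
  refine ⟨?_, by dsimp only; split_ifs <;> omega, fun _ => ?_⟩
  · dsimp only
    split_ifs with h1 h2
    · rw [h1, K.P2.getVert_zero, number, if_neg (by omega), if_pos rfl]
    · rw [h2, h.right_eq, number, if_pos (by omega), ← h.length_eq, p.getVert_length]
    · rcases hk.lt_or_eq with h3 | rfl
      · rw [number, if_neg (by omega), if_neg (by omega), if_neg (by omega), if_neg (by omega),
          if_neg (by omega)]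
        congr 1
        omega
      · rw [number, if_neg (by omega), if_neg (by omega), if_neg (by omega), if_neg (by omega),
          if_pos (by omega), K.P2.getVert_length,
          show 6 * ℓ - 1 - K.P2.length + 1 - 4 * ℓ = K.L2.length by rw [h.length_L2]; omega,
          K.L2.getVert_length]
  · dsimp only
    split_ifs <;>
      first | (exfalso; omega) | (unfold modelAdj; repeat first | (constructor <;> omega) | right)

theorem number_Q1 (h : K.IsHandle ℓ p) (hℓ : 5 ≤ ℓ) :
    IsNumberedBy ℓ (K.number ℓ p) K.Q1 (fun k => 2 * ℓ + 1 - k) := by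
  intro k hk
  have := h.length_Q1
  have hL := (h.number_L2 hℓ 0 (Nat.zero_le _)).1
  have hP := (h.number_P2 hℓ 0 (Nat.zero_le _)).1
  simp only [Walk.getVert_zero, if_true] at hL hP
  dsimp only
  refine ⟨?_, by omega, fun _ => Or.inr (Or.inl ⟨by omega, by omega⟩)⟩
  rcases Nat.eq_zero_or_pos k with rfl | h0
  · rw [Walk.getVert_zero, hL, Nat.sub_zero]
  · rw [Walk.getVert_of_length_le _ (by omega), hP]
    congr 1
    omega

theorem number_Q2 (h : K.IsHandle ℓ p) (hℓ : 5 ≤ ℓ) :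
    IsNumberedBy ℓ (K.number ℓ p) K.Q2 (fun k => if k = 0 then 3 * ℓ + 1 else 5 * ℓ - 1) := by
  intro k hk
  have := h.length_Q2
  have hP := (h.number_P1 hℓ 0 (Nat.zero_le _)).1
  have hL := (h.number_L2 hℓ _ le_rfl).1
  simp only [Walk.getVert_zero, Nat.sub_zero] at hP
  dsimp only at hL
  rw [Walk.getVert_length, h.length_L2, if_neg (by omega)] at hL
  refine ⟨?_, by dsimp only; split_ifs <;> omega, fun _ => ?_⟩
  · dsimp only
    split_ifs with h1
    · rw [h1, Walk.getVert_zero, hP]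
    · rw [Walk.getVert_of_length_le _ (by omega), hL]
      congr 1
      omega
  · dsimp only
    split_ifs <;>
      first | (exfalso; omega) | (unfold modelAdj; repeat first | (constructor <;> omega) | right)

theorem exists_number_eq (h : K.IsHandle ℓ p) (hℓ : 5 ≤ ℓ) {v : V} (hv : v ∈ K.verts) :
    ∃ i, (i = 0 ∨ 2 * ℓ - 1 ≤ i) ∧ i < 6 * ℓ - 2 ∧ K.number ℓ p i = v := by
  have key : ∀ {a b : V} {q : G.Walk a b} {φ : ℕ → ℕ}, IsNumberedBy ℓ (K.number ℓ p) q φ →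
      (∀ k ≤ q.length, φ k = 0 ∨ 2 * ℓ - 1 ≤ φ k) → v ∈ q.support →
      ∃ i, (i = 0 ∨ 2 * ℓ - 1 ≤ i) ∧ i < 6 * ℓ - 2 ∧ K.number ℓ p i = v := by
    intro a b q φ hq hφ hv
    obtain ⟨k, rfl, hk⟩ := Walk.mem_support_iff_exists_getVert.1 hv
    exact ⟨φ k, hφ k hk, (hq k hk).2.1, (hq k hk).1.symm⟩
  rcases K.mem_verts_iff_s14.1 hv with hv | hv | hv | hv | hv | hv
  · exact key (h.number_P1 hℓ) (fun k hk => by rw [h.length_P1] at hk; omega) hv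
  · exact key (h.number_P2 hℓ) (fun k hk => by rw [h.length_P2] at hk; split_ifs <;> omega) hv
  · exact key (h.number_Q1 hℓ) (fun k hk => by rw [h.length_Q1] at hk; omega) hv
  · exact key (h.number_Q2 hℓ) (fun k hk => by split_ifs <;> omega) hv
  · exact key (h.number_L1 hℓ) (fun k hk => by split_ifs <;> omega) hv
  · exact key (h.number_L2 hℓ) (fun k hk => by split_ifs <;> omega) hv

theorem adj_number (h : K.IsHandle ℓ p) (hℓ : 5 ≤ ℓ) {i j : ℕ} (hi : i < 6 * ℓ - 2)
    (hj : j < 6 * ℓ - 2) (hij : modelAdj ℓ i j) :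
    G.Adj (K.number ℓ p i) (K.number ℓ p j) := by
  have hP1 := h.length_P1
  have hP2 := h.length_P2
  have hQ1 := h.length_Q1
  have hQ2 := h.length_Q2
  have hL1 := h.length_L1
  have hL2 := h.length_L2
  have hp := h.length_eq
  have succ : ∀ i, i + 1 < 6 * ℓ - 2 → i + 1 ≠ 4 * ℓ →
      G.Adj (K.number ℓ p i) (K.number ℓ p (i + 1)) := by
    intro i hi hi4
    rcases lt_or_ge i (2 * ℓ - 1) with h1 | h1
    · exact (h.number_self hℓ).adj i (by omega) rfl rfl
    rcases h1.eq_or_lt with rfl | h1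
    · refine ((h.number_P2 hℓ).adj 0 (by omega) ?_ ?_).symm <;> grind
    rcases lt_or_ge i (2 * ℓ + 1) with h2 | h2
    · refine ((h.number_Q1 hℓ).adj 0 (by omega) ?_ ?_).symm <;> omega
    rcases lt_or_ge i (3 * ℓ + 1) with h3 | h3
    · refine ((h.number_P1 hℓ).adj (3 * ℓ - i) (by omega) ?_ ?_).symm <;> omega
    rcases lt_or_ge i (4 * ℓ - 1) with h4 | h4
    · refine (h.number_L1 hℓ).adj (i - (3 * ℓ + 1)) (by omega) ?_ ?_ <;> grind
    rcases lt_or_ge i (5 * ℓ - 1) with h5 | h5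
    · refine (h.number_L2 hℓ).adj (i - (4 * ℓ - 1)) (by omega) ?_ ?_ <;> grind
    · refine ((h.number_P2 hℓ).adj (6 * ℓ - 2 - i) (by omega) ?_ ?_).symm <;> grind
  have zero : G.Adj (K.number ℓ p 0) (K.number ℓ p (2 * ℓ)) := by
    refine (h.number_L1 hℓ).adj (ℓ - 1) (by omega) ?_ ?_ <;> grind
  have zero' : G.Adj (K.number ℓ p (4 * ℓ - 1)) (K.number ℓ p 0) := by
    refine (h.number_L1 hℓ).adj (ℓ - 2) (by omega) ?_ ?_ <;> grind
  have two : G.Adj (K.number ℓ p (2 * ℓ + 1)) (K.number ℓ p (4 * ℓ)) := by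
    refine (h.number_L2 hℓ).adj 0 (by omega) ?_ ?_ <;> grind
  have three : G.Adj (K.number ℓ p (3 * ℓ + 1)) (K.number ℓ p (5 * ℓ - 1)) := by
    refine (h.number_Q2 hℓ).adj 0 (by omega) ?_ ?_ <;> grind
  have last : G.Adj (K.number ℓ p (2 * ℓ - 1)) (K.number ℓ p (6 * ℓ - 3)) := by
    refine (h.number_P2 hℓ).adj 1 (by omega) ?_ ?_ <;> grind
  have key : ∀ i j, i < 6 * ℓ - 2 → j < 6 * ℓ - 2 →
      ((j = i + 1 ∧ j ≠ 4 * ℓ) ∨ (i = 0 ∧ j = 2 * ℓ) ∨ (i = 0 ∧ j + 1 = 4 * ℓ) ∨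
        (i = 2 * ℓ + 1 ∧ j = 4 * ℓ) ∨ (i = 3 * ℓ + 1 ∧ j + 1 = 5 * ℓ) ∨
        (i + 1 = 2 * ℓ ∧ j + 3 = 6 * ℓ)) → G.Adj (K.number ℓ p i) (K.number ℓ p j) := by
    rintro i j hi hj (⟨rfl, h⟩ | ⟨rfl, rfl⟩ | ⟨rfl, h⟩ | ⟨rfl, rfl⟩ | ⟨rfl, h⟩ | ⟨h, h'⟩)
    · exact succ i hj h
    · exact zero
    · rw [← Nat.eq_sub_of_add_eq h] at zero'
      exact zero'.symm
    · exact two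
    · rwa [← Nat.eq_sub_of_add_eq h] at three
    · rwa [← Nat.eq_sub_of_add_eq h, ← Nat.eq_sub_of_add_eq h'] at last
  rcases hij with h | h | h | h | h | h | h | h | h | h | h | h
  · exact key i j hi hj (.inl h)
  · exact (key j i hj hi (.inl h)).symm
  · exact key i j hi hj (.inr (.inl h))
  · exact (key j i hj hi (.inr (.inl h))).symm
  · exact key i j hi hj (.inr (.inr (.inl h)))
  · exact (key j i hj hi (.inr (.inr (.inl h)))).symm
  · exact key i j hi hj (.inr (.inr (.inr (.inl h))))
  · exact (key j i hj hi (.inr (.inr (.inr (.inl h))))).symm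
  · exact key i j hi hj (.inr (.inr (.inr (.inr (.inl h)))))
  · exact (key j i hj hi (.inr (.inr (.inr (.inr (.inl h)))))).symm
  · exact key i j hi hj (.inr (.inr (.inr (.inr (.inr h)))))
  · exact (key j i hj hi (.inr (.inr (.inr (.inr (.inr h)))))).symm

end OddK4.IsHandle

theorem OddK4.mem_verts_of_mem_interiorL {G : SimpleGraph V} (K : OddK4 G) {v : V}
    (hv : v ∈ interiorL K.P1 ++ interiorL K.P2 ++ interiorL K.Q1 ++ interiorL K.Q2 ++
      interiorL K.L1 ++ interiorL K.L2) : v ∈ K.verts := by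
  have key : ∀ {a b : V} (q : G.Walk a b), v ∈ interiorL q → v ∈ q.support :=
    fun q h => List.mem_of_mem_tail (List.mem_of_mem_dropLast h)
  simp only [List.mem_append] at hv
  rw [K.mem_verts_iff_s14]
  rcases hv with ((((hv | hv) | hv) | hv) | hv) | hv <;> simp only [key _ hv, true_or, or_true]

/-- A colouring distinguishing the parts of a `K₄`-subdivision. -/
theorem OddK4.exists_part {G : SimpleGraph V} (K : OddK4 G) :
    ∃ c : V → ℕ, (∀ v, v ∉ K.verts → c v = 0) ∧
      (c K.u1 = 1 ∧ c K.u2 = 2 ∧ c K.u3 = 3 ∧ c K.u4 = 4) ∧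
      (∀ v ∈ interiorL K.P1, c v = 5) ∧ (∀ v ∈ interiorL K.L1, c v = 6) ∧
      (∀ v ∈ interiorL K.L2, c v = 7) ∧ (∀ v ∈ interiorL K.P2, c v = 8) := by
  classical
  have hverts := fun v => K.mem_verts_of_mem_interiorL (v := v)
  have hbranch := K.hbranch
  have hdisj := K.hdisj
  have hnodup := K.hnodup
  have h1 : K.u1 ∈ K.verts := K.mem_verts_iff_s14.2 (by simp)
  have h2 : K.u2 ∈ K.verts := K.mem_verts_iff_s14.2 (by simp)
  have h3 : K.u3 ∈ K.verts := K.mem_verts_iff_s14.2 (by simp)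
  have h4 : K.u4 ∈ K.verts := K.mem_verts_iff_s14.2 (by simp)
  simp only [List.mem_append, List.mem_cons, List.not_mem_nil, or_false, not_or, List.nodup_cons,
    List.pairwise_cons, forall_eq_or_imp, List.Disjoint] at hverts hbranch hdisj hnodup
  refine ⟨fun v => if v ∉ K.verts then 0 else if v = K.u1 then 1 else if v = K.u2 then 2
    else if v = K.u3 then 3 else if v = K.u4 then 4 else if v ∈ interiorL K.P1 then 5
    else if v ∈ interiorL K.L1 then 6 else if v ∈ interiorL K.L2 then 7 else 8,
    ?_, ⟨?_, ?_, ?_, ?_⟩, ?_, ?_, ?_, ?_⟩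
  · intro v hv
    simp [hv]
  · simp [h1]
  · simp [h2, Ne.symm hnodup.1.1]
  · simp [h3, Ne.symm hnodup.1.2.1, Ne.symm hnodup.2.1.1]
  · simp [h4, Ne.symm hnodup.1.2.2, Ne.symm hnodup.2.1.2, Ne.symm hnodup.2.2.1]
  all_goals
    intro v hv
    have hb := hbranch v (by simp only [hv, true_or, or_true])
    have hm := hverts v (by simp only [hv, true_or, or_true])
    simp only [hm, not_true, if_false, hb.1, hb.2.1, hb.2.2.1, hb.2.2.2]
  · simp [hv]
  · rw [if_neg fun h => hdisj.1.2.2.2.1 h hv, if_pos hv]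
  · rw [if_neg fun h => hdisj.1.2.2.2.2 _ rfl h hv, if_neg fun h => hdisj.2.2.2.2.1 _ rfl h hv,
      if_pos hv]
  · rw [if_neg fun h => hdisj.1.1 h hv, if_neg fun h => hdisj.2.1.2.2.1 hv h,
      if_neg fun h => hdisj.2.1.2.2.2 _ rfl hv h]

theorem OddK4.number_mem {G : SimpleGraph V} (K : OddK4 G) (ℓ : ℕ) {x y : V} (p : G.Walk x y)
    (i : ℕ) :
    K.number ℓ p i ∈ K.verts ∨ K.number ℓ p i ∈ p.support := by
  rw [K.mem_verts_iff_s14]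
  unfold number
  split_ifs <;> simp [Walk.getVert_mem_support]

namespace OddK4.IsHandle

variable {G : SimpleGraph V} {K : OddK4 G} {ℓ : ℕ} {x y : V} {p : G.Walk x y}

theorem number_injOn (h : K.IsHandle ℓ p) (hℓ : 5 ≤ ℓ) {i j : ℕ} (hi : i < 6 * ℓ - 2)
    (hj : j < 6 * ℓ - 2) (hij : K.number ℓ p i = K.number ℓ p j) : i = j := by
  obtain ⟨c, h0, ⟨hu1, hu2, hu3, hu4⟩, hcP1, hcL1, hcL2, hcP2⟩ := K.exists_part
  have hP1 := h.length_P1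
  have hP2 := h.length_P2
  have hL1 := h.length_L1
  have hL2 := h.length_L2
  have hp := h.length_eq
  have main : ∀ i, i < 6 * ℓ - 2 →
      (∃ k, 0 < k ∧ k < 2 * ℓ - 1 ∧ i = k ∧ p.getVert k = K.number ℓ p i ∧
        c (K.number ℓ p i) = 0) ∨
      (i = 3 * ℓ + 1 ∧ c (K.number ℓ p i) = 1) ∨ (i = 2 * ℓ + 1 ∧ c (K.number ℓ p i) = 2) ∨
      (i = 2 * ℓ ∧ c (K.number ℓ p i) = 3) ∨ (i = 5 * ℓ - 1 ∧ c (K.number ℓ p i) = 4) ∨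
      (∃ k, 0 < k ∧ k < ℓ ∧ i = 3 * ℓ + 1 - k ∧ K.P1.getVert k = K.number ℓ p i ∧
        c (K.number ℓ p i) = 5) ∨
      (∃ k, 0 < k ∧ k < ℓ ∧ i = (if k + 1 < ℓ then 3 * ℓ + 1 + k else 0) ∧
        K.L1.getVert k = K.number ℓ p i ∧ c (K.number ℓ p i) = 6) ∨
      (∃ k, 0 < k ∧ k < ℓ ∧ i = 4 * ℓ - 1 + k ∧ K.L2.getVert k = K.number ℓ p i ∧
        c (K.number ℓ p i) = 7) ∨
      (∃ k, 0 < k ∧ k < ℓ ∧ i = (if k = 1 then 2 * ℓ - 1 else 6 * ℓ - 1 - k) ∧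
        K.P2.getVert k = K.number ℓ p i ∧ c (K.number ℓ p i) = 8) := by
    intro i hi
    have aux : ∀ {a b : V} (q : G.Walk a b) {φ : ℕ → ℕ} {m : ℕ},
        IsNumberedBy ℓ (K.number ℓ p) q φ → (∀ v ∈ interiorL q, c v = m) → q.length = ℓ →
        ∀ k, 0 < k → k < ℓ → φ k = i → ∃ k, 0 < k ∧ k < ℓ ∧ i = φ k ∧
          q.getVert k = K.number ℓ p i ∧ c (K.number ℓ p i) = m := by
      intro a b q φ m hq hm hlen k hk hk' hφ
      have hv := (hq k (by omega)).1
      rw [hφ] at hv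
      exact ⟨k, hk, hk', hφ.symm, hv,
        hv ▸ hm _ ((mem_interiorL_iff q).2 ⟨k, hk, by omega, rfl⟩)⟩
    rcases Nat.eq_zero_or_pos i with rfl | hi0
    · obtain ⟨k, hk, hk', hik, hv⟩ := aux K.L1 (h.number_L1 hℓ) hcL1 hL1 (ℓ - 1) (by omega)
        (by omega) (by grind)
      exact .inr <| .inr <| .inr <| .inr <| .inr <| .inr <| .inl ⟨k, hk, hk', by grind, hv⟩
    rcases lt_or_ge i (2 * ℓ - 1) with h1 | h1
    · have hv := (h.number_self hℓ i (by omega)).1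
      rw [id] at hv
      exact .inl ⟨i, hi0, h1, rfl, hv, hv ▸ h0 _ (h.not_mem i hi0 (by omega))⟩
    rcases h1.eq_or_lt with rfl | h1
    · exact .inr <| .inr <| .inr <| .inr <| .inr <| .inr <| .inr <| .inr (by
        obtain ⟨k, hk, hk', hik, hv⟩ := aux K.P2 (h.number_P2 hℓ) hcP2 hP2 1 (by omega)
          (by omega) (by grind)
        exact ⟨k, hk, hk', by grind, hv⟩)
    rcases (show 2 * ℓ ≤ i by omega).eq_or_lt with rfl | h2
    · have hv := (h.number_P2 hℓ 0 (Nat.zero_le _)).1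
      simp only [Walk.getVert_zero, if_true] at hv
      exact .inr <| .inr <| .inr <| .inl ⟨rfl, hv ▸ hu3⟩
    rcases (show 2 * ℓ + 1 ≤ i by omega).eq_or_lt with rfl | h3
    · have hv := (h.number_L2 hℓ 0 (Nat.zero_le _)).1
      simp only [Walk.getVert_zero, if_true] at hv
      exact .inr <| .inr <| .inl ⟨rfl, hv ▸ hu2⟩
    rcases lt_or_ge i (3 * ℓ + 1) with h4 | h4
    · exact .inr <| .inr <| .inr <| .inr <| .inr <| .inl <|
        aux K.P1 (h.number_P1 hℓ) hcP1 hP1 (3 * ℓ + 1 - i) (by omega) (by omega) (by omega)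
    rcases h4.eq_or_lt with rfl | h4
    · have hv := (h.number_P1 hℓ 0 (Nat.zero_le _)).1
      simp only [Walk.getVert_zero, Nat.sub_zero] at hv
      exact .inr <| .inl ⟨rfl, hv ▸ hu1⟩
    rcases lt_or_ge i (4 * ℓ) with h5 | h5
    · obtain ⟨k, hk, hk', hik, hv⟩ := aux K.L1 (h.number_L1 hℓ) hcL1 hL1 (i - (3 * ℓ + 1))
        (by omega) (by omega) (by grind)
      exact .inr <| .inr <| .inr <| .inr <| .inr <| .inr <| .inl ⟨k, hk, hk', by grind, hv⟩
    rcases lt_or_ge i (5 * ℓ - 1) with h6 | h6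
    · obtain ⟨k, hk, hk', hik, hv⟩ := aux K.L2 (h.number_L2 hℓ) hcL2 hL2 (i - (4 * ℓ - 1))
        (by omega) (by omega) (by grind)
      exact .inr <| .inr <| .inr <| .inr <| .inr <| .inr <| .inr <| .inl
        ⟨k, hk, hk', by grind, hv⟩
    rcases h6.eq_or_lt with rfl | h6
    · have hv := (h.number_L2 hℓ _ le_rfl).1
      dsimp only at hv
      rw [Walk.getVert_length, hL2, if_neg (by omega),
        show 4 * ℓ - 1 + ℓ = 5 * ℓ - 1 by omega] at hv
      exact .inr <| .inr <| .inr <| .inr <| .inl ⟨rfl, hv ▸ hu4⟩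
    · obtain ⟨k, hk, hk', hik, hv⟩ := aux K.P2 (h.number_P2 hℓ) hcP2 hP2 (6 * ℓ - 1 - i)
        (by omega) (by omega) (by grind)
      exact .inr <| .inr <| .inr <| .inr <| .inr <| .inr <| .inr <| .inr
        ⟨k, hk, hk', by grind, hv⟩
  have hinj : ∀ {a b : V} {q : G.Walk a b}, q.IsPath → ∀ {k k' : ℕ}, k < q.length →
      k' < q.length → q.getVert k = K.number ℓ p i → q.getVert k' = K.number ℓ p j → k = k' :=
    fun hq k k' hk hk' h1 h2 => hq.getVert_injOn hk.le hk'.le (h1.trans (hij.trans h2.symm))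
  have hi' := main i hi
  have hj' := main j hj
  have hc := congrArg c hij
  rcases hi' with ⟨k, -, hk, rfl, hv, h1⟩ | ⟨rfl, h1⟩ | ⟨rfl, h1⟩ | ⟨rfl, h1⟩ | ⟨rfl, h1⟩ |
      ⟨k, -, hk, hik, hv, h1⟩ | ⟨k, -, hk, hik, hv, h1⟩ | ⟨k, -, hk, hik, hv, h1⟩ |
      ⟨k, -, hk, hik, hv, h1⟩ <;>
    rcases hj' with ⟨k', -, hk', rfl, hv', h2⟩ | ⟨rfl, h2⟩ | ⟨rfl, h2⟩ | ⟨rfl, h2⟩ | ⟨rfl, h2⟩ |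
      ⟨k', -, hk', hik', hv', h2⟩ | ⟨k', -, hk', hik', hv', h2⟩ | ⟨k', -, hk', hik', hv', h2⟩ |
      ⟨k', -, hk', hik', hv', h2⟩ <;>
    first | rfl | (exfalso; omega) | skip
  · exact hinj h.isPath (by omega) (by omega) hv hv'
  · rw [hik, hik', hinj K.hP1 (by omega) (by omega) hv hv']
  · rw [hik, hik', hinj K.hL1 (by omega) (by omega) hv hv']
  · rw [hik, hik', hinj K.hL2 (by omega) (by omega) hv hv']
  · rw [hik, hik', hinj K.hP2 (by omega) (by omega) hv hv']

theorem adj_number_iff (h : K.IsHandle ℓ p) (hℓ : 5 ≤ ℓ)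
    (hchord : ∀ u v, (u ∈ K.verts ∨ u ∈ p.support) → (v ∈ K.verts ∨ v ∈ p.support) →
      G.Adj u v → s(u, v) ∈ K.toSubgraph.edgeSet ∨ s(u, v) ∈ p.edges)
    {i j : ℕ} (hi : i < 6 * ℓ - 2) (hj : j < 6 * ℓ - 2) :
    G.Adj (K.number ℓ p i) (K.number ℓ p j) ↔ modelAdj ℓ i j := by
  refine ⟨fun hadj => ?_, h.adj_number hℓ hi hj⟩
  have key : ∃ a b, a < 6 * ℓ - 2 ∧ b < 6 * ℓ - 2 ∧ modelAdj ℓ a b ∧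
      K.number ℓ p i = K.number ℓ p a ∧ K.number ℓ p j = K.number ℓ p b := by
    have he := hchord _ _ (K.number_mem ℓ p i) (K.number_mem ℓ p j) hadj
    rw [K.mem_edgeSet_iff] at he
    rcases he with (he | he | he | he | he | he) | he
    · exact (h.number_P1 hℓ).exists_modelAdj he
    · exact (h.number_P2 hℓ).exists_modelAdj he
    · exact (h.number_Q1 hℓ).exists_modelAdj he
    · exact (h.number_Q2 hℓ).exists_modelAdj he
    · exact (h.number_L1 hℓ).exists_modelAdj he
    · exact (h.number_L2 hℓ).exists_modelAdj he
    · exact (h.number_self hℓ).exists_modelAdj he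
  obtain ⟨a, b, ha, hb, hab, hia, hjb⟩ := key
  rwa [h.number_injOn hℓ hi ha hia, h.number_injOn hℓ hj hb hjb]

end OddK4.IsHandle

/-- Claim 3.5: in the setup of the proof of Theorem 1.2, assume
additionally that `P'` has the structure of Claim 3.4. Then no vertex outside
`V(H ∪ P')` has two neighbours in `V(H ∪ P')`. -/
theorem claim_no_two_neighbours_HP {V : Type*}
    (ℓ : ℕ) (hℓ : 5 ≤ ℓ) (G : SimpleGraph V)
    (hG : InGFamily ℓ G) (hcrit : VertexCritical 4 G)
    (K : OddK4 G) (hlong : K.longestPair)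
    (hmin : ∀ K' : OddK4 G, K'.longestPair → K.diff ≤ K'.diff)
    (e f : Sym2 V)
    (he : e = s(K.u3, K.P2.getVert 1))
    (hf : f = s(K.u4, K.P2.getVert (K.P2.length - 1)))
    (v1 v2 : V) (P : (G.deleteEdges {e, f}).Walk v1 v2)
    (hPind : IsInducedPath (G.deleteEdges {e, f}) P)
    (hPdisj : ∀ w ∈ P.support, w ∉ K.verts)
    (hv2nbr : ∃ z ∈ interiorL K.P2, (G.deleteEdges {e, f}).Adj v2 z)
    (hv2only : ∀ w ∈ P.support,
      (∃ z ∈ interiorL K.P2, (G.deleteEdges {e, f}).Adj w z) → w = v2)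
    (hv1nbr : ∃ z : V, z ∈ K.verts ∧ z ∉ interiorL K.P2 ∧ (G.deleteEdges {e, f}).Adj v1 z)
    (hv1only : ∀ w ∈ P.support,
      (∃ z : V, z ∈ K.verts ∧ z ∉ interiorL K.P2 ∧ (G.deleteEdges {e, f}).Adj w z) → w = v1)
    (x y : V)
    (hy : y ∈ interiorL K.P2) (hv2y : G.Adj v2 y)
    (hyuniq : ∀ z ∈ interiorL K.P2, G.Adj v2 z → z = y)
    (hxH : x ∈ K.verts) (hxP2 : x ∉ interiorL K.P2) (hv1x : G.Adj v1 x)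
    (hxuniq : ∀ z : V, z ∈ K.verts → z ∉ interiorL K.P2 → G.Adj v1 z → z = x)
    (P' : G.Walk x y)
    (hP' : P' = Walk.cons hv1x.symm ((P.mapLe (G.deleteEdges_le {e, f})).concat hv2y))
    (hxL1 : x ∈ interiorL K.L1)
    (hQ1len : K.Q1.length = 1) (hP1len : K.P1.length = ℓ) (hL1len : K.L1.length = ℓ)
    (hP'len : P'.length = 2 * ℓ - 1)
    (hxu3 : K.toSubgraph.Adj x K.u3) (hu3y : K.toSubgraph.Adj K.u3 y)
    (h1 : G.Adj x K.u3) (h2 : G.Adj K.u3 y)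
    (hhole : IsOddHole G (Walk.cons h1 (Walk.cons h2 P'.reverse)))
    : ∀ w : V, w ∉ K.verts → w ∉ P'.support →
      ∀ a b : V, (a ∈ K.verts ∨ a ∈ P'.support) → (b ∈ K.verts ∨ b ∈ P'.support) →
        G.Adj w a → G.Adj w b → a = b := by
  have hgirth : ∀ (v : V) (c : G.Walk v v), c.IsCycle → 2 * ℓ + 1 ≤ c.length := fun v c hc => by
    exact_mod_cast le_egirth.1 hG.1.ge v c hc
  have hf1 := hG.2 _ _ K.face1
  have hf2 := hG.2 _ _ K.face2
  have hf3 := hG.2 _ _ K.face3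
  have hf4 := hG.2 _ _ K.face4
  simp only [Walk.length_append, Walk.length_reverse] at hf1 hf2 hf3 hf4
  have hsupp : ∀ v, v ∈ P'.support ↔ v = x ∨ v ∈ P.support ∨ v = y := by
    intro v
    simp [hP', Walk.support_concat]
  have hedge : ∀ e ∈ P'.edges, e = s(x, v1) ∨ e ∈ P.edges ∨ e = s(v2, y) := by
    intro e he
    simpa [hP', Walk.edges_concat, or_assoc, Walk.edges_mapLe_eq_edges] using he
  have hedge1 : s(x, v1) ∈ P'.edges := by simp [hP']
  have hedge2 : s(v2, y) ∈ P'.edges := by simp [hP', Walk.edges_concat]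
  have hyK : y ∈ K.verts := K.mem_verts_of_mem_interiorL (by simp [hy])
  have hu3K : K.u3 ∈ K.verts := K.mem_verts_iff_s14.2 (by simp)
  have hpath : P'.IsPath := by
    have := ((Walk.cons_isCycle_iff _ _).1 hhole.1.1).1
    rw [Walk.cons_isPath_iff, Walk.isPath_reverse_iff] at this
    exact this.1
  have hK : K.IsHandle ℓ P' := by
    refine ⟨by omega, by omega, by omega, by omega, by omega, by omega, ?_, ?_, hP'len, hpath, ?_⟩
    · have := getVert_of_adj_last hgirth K.hL1 (by omega)
        (List.mem_of_mem_tail (List.mem_of_mem_dropLast hxL1)) h1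
      rwa [hL1len] at this
    · have := getVert_of_adj_last hgirth K.hP2.reverse (by rw [Walk.length_reverse]; omega)
        (by
          rw [Walk.support_reverse, List.mem_reverse]
          exact List.mem_of_mem_tail (List.mem_of_mem_dropLast hy)) h2.symm
      rwa [Walk.getVert_reverse, Walk.length_reverse,
        show K.P2.length - (K.P2.length - 1) = 1 by omega] at this
    · intro k hk hk'
      rcases (hsupp _).1 (P'.getVert_mem_support k) with h | h | h
      · have := hpath.getVert_injOn hk'.le (Nat.zero_le _) (h.trans P'.getVert_zero.symm)
        omega
      · exact hPdisj _ h
      · have := hpath.getVert_injOn hk'.le (le_refl P'.length) (h.trans P'.getVert_length.symm)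
        omega
  have hclosed := fun a b ha hb => K.exists_short_closed_walk (n := 2 * ℓ + 2) (a := a) (b := b)
    (by omega) (by omega) (by omega) (by omega) (by omega) (by omega) ha hb
  have hcross : ∀ u v, u ∈ K.verts → v ∈ P.support → G.Adj u v → s(u, v) ∈ P'.edges := by
    intro u v hu hv huv
    have hdel : (G.deleteEdges {e, f}).Adj v u := by
      rw [deleteEdges_adj]
      refine ⟨huv.symm, fun h => hPdisj v hv ?_⟩
      have hP2 : ∀ z ∈ K.P2.support, z ∈ K.verts := fun z hz => K.mem_verts_iff_s14.2 (by simp [hz])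
      have hu4K : K.u4 ∈ K.verts := K.mem_verts_iff_s14.2 (by simp)
      simp only [he, hf, Set.mem_insert_iff, Set.mem_singleton_iff, Sym2.eq_iff] at h
      rcases h with (⟨h, -⟩ | ⟨h, -⟩) | (⟨h, -⟩ | ⟨h, -⟩)
      · exact h ▸ hu3K
      · exact h ▸ hP2 _ (Walk.getVert_mem_support _ _)
      · exact h ▸ hu4K
      · exact h ▸ hP2 _ (Walk.getVert_mem_support _ _)
    by_cases huP : u ∈ interiorL K.P2
    · obtain rfl := hv2only v hv ⟨u, huP, hdel⟩
      obtain rfl := hyuniq u huP huv.symm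
      rwa [Sym2.eq_swap]
    · obtain rfl := hv1only v hv ⟨u, hu, huP, hdel⟩
      obtain rfl := hxuniq u hu huP huv.symm
      exact hedge1
  have hmemP : ∀ v, v ∈ P'.support → v ∈ K.verts ∨ v ∈ P.support := by
    intro v hv
    rcases (hsupp v).1 hv with rfl | h | rfl
    · exact .inl hxH
    · exact .inr h
    · exact .inl hyK
  have hmem : ∀ v, (v ∈ K.verts ∨ v ∈ P'.support) → v ∈ K.verts ∨ v ∈ P.support :=
    fun v hv => hv.elim .inl (hmemP v)
  have hchord : ∀ u v, (u ∈ K.verts ∨ u ∈ P'.support) → (v ∈ K.verts ∨ v ∈ P'.support) →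
      G.Adj u v → s(u, v) ∈ K.toSubgraph.edgeSet ∨ s(u, v) ∈ P'.edges := by
    intro u v hu hv huv
    rcases hmem u hu with hu | hu <;> rcases hmem v hv with hv | hv
    · obtain ⟨z, c, hlen, huc, hvc, -, hc⟩ := hclosed u v hu hv
      exact .inl (hc _ (mem_edges_of_short_closed_walk hgirth c (by omega) huc hvc huv))
    · exact .inr (hcross u v hu hv huv)
    · exact .inr (Sym2.eq_swap ▸ hcross v u hv hu huv.symm)
    · have := hhole.1.2.2 u (by simp [hsupp, hu]) v (by simp [hsupp, hv]) huv
      simp only [Walk.edges_cons, Walk.edges_reverse, List.mem_cons, List.mem_reverse] at this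
      rcases this with h | h | h
      · exact .inl (h ▸ hxu3)
      · exact .inl (h ▸ hu3y)
      · exact .inr h
  intro w hwK hwP a b ha hb hwa hwb
  by_contra hne
  have hwH : ∀ a b, a ∈ K.verts → b ∈ K.verts → G.Adj w a → G.Adj w b → a = b := by
    intro a b ha hb hwa hwb
    obtain ⟨z, c, hlen, hac, hbc, hc, -⟩ := hclosed a b ha hb
    exact eq_of_adj_short_closed_walk hgirth c (by omega) (fun h => hwK (hc w h)) hac hbc hwa hwb
  have hwC : ∀ a b, (a = K.u3 ∨ a ∈ P'.support) → (b = K.u3 ∨ b ∈ P'.support) →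
      G.Adj w a → G.Adj w b → a = b := by
    intro a b ha hb hwa hwb
    refine eq_of_adj_short_closed_walk hgirth (Walk.cons h1 (Walk.cons h2 P'.reverse)) ?_ ?_ ?_ ?_
      hwa hwb
    · simp only [Walk.length_cons, Walk.length_reverse]
      omega
    · have hw3 : w ≠ K.u3 := fun h => hwK (h ▸ hu3K)
      have hwx : w ≠ x := fun h => hwK (h ▸ hxH)
      simp [hwP, hw3, hwx]
    · rcases ha with h | h <;> simp [h]
    · rcases hb with h | h <;> simp [h]
  have hw : ∀ i, i < 6 * ℓ - 2 → w ≠ K.number ℓ P' i := fun i _ h =>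
    (K.number_mem ℓ P' i).elim (fun h1 => hwK (h ▸ h1)) (fun h1 => hwP (h ▸ h1))
  have main : ∀ a b, a ≠ b → a ∈ K.verts → b ∈ P.support → G.Adj w a → G.Adj w b → False := by
    intro a b hne ha hb hwa hwb
    have hbP := (hsupp b).2 (.inr (.inl hb))
    obtain ⟨i, hi0, hi, rfl⟩ := hK.exists_number_eq hℓ ha
    obtain ⟨s, rfl, hs⟩ := Walk.mem_support_iff_exists_getVert.1 hbP
    have hPn : ∀ k ≤ P'.length, P'.getVert k = K.number ℓ P' k := fun k hk =>
      (hK.number_self hℓ k hk).1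
    have hs0 : s ≠ 0 := by
      rintro rfl
      exact hPdisj _ hb (by rwa [P'.getVert_zero])
    have hs1 : s ≠ P'.length := by
      rintro rfl
      exact hPdisj _ hb (by rwa [P'.getVert_length])
    have hi1 : 2 * ℓ + 1 ≤ i := by
      by_contra hcon
      refine hne (hwC _ _ ?_ (.inr hbP) hwa hwb)
      rcases lt_or_ge i (2 * ℓ) with h | h
      · right
        rw [← hPn i (by omega)]
        exact P'.getVert_mem_support i
      · left
        rw [OddK4.number, if_neg (by omega), if_pos (by omega)]
    rw [hPn s hs] at hwb hbP
    refine no_model_neighbours hℓ hgirth hG.2 (fun i j hi hj => hK.number_injOn hℓ hi hj)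
      (fun i j hi hj => hK.adj_number_iff hℓ hchord hi hj) hw hwa hwb ?_ hi1 hi (by omega)
      (by omega)
    intro k hk hwk
    rcases K.number_mem ℓ P' k with h | h
    · exact .inl (hK.number_injOn hℓ hk hi (hwH _ _ h ha hwk hwa))
    · exact .inr (hK.number_injOn hℓ hk (by omega) (hwC _ _ (.inr h) (.inr hbP) hwk hwb))
  rcases hmem a ha with ha' | ha' <;> rcases hmem b hb with hb' | hb'
  · exact hne (hwH a b ha' hb' hwa hwb)
  · exact main a b hne ha' hb' hwa hwb
  · exact main b a (Ne.symm hne) hb' ha' hwb hwa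
  · exact hne (hwC a b (.inr ((hsupp a).2 (.inr (.inl ha'))))
      (.inr ((hsupp b).2 (.inr (.inl hb')))) hwa hwb)
end
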